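/- arXiv:2406.00129 — 8 statements merged into one kernel-verified Lean document; each statement's English description precedes it below -/
import Mathlib

section
/- Let r and s be even non-negative integers and let m > 1 be an integer with r + s = φ(m). Then there exist a φ(m) × φ(m) symmetric integer matrix G with every diagonal entry even, det G ≠ 0, and signature (r, s), and an integer matrix θ with characteristic polynomial Φ_m and θᵀ G θ = G (so θ is an isometric automorphism of order m of the even lattice with Gram matrix G). -/
open Matrix Polynomial

/-- The matrix, in the basis `1, X, …, X ^ (n - 1)`, of multiplication by `X` modulo `f`. -/
noncomputable def mulXModMatrix (n : ℕ) (f : ℤ[X]) : Matrix (Fin n) (Fin n) ℤ :=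
  Matrix.of fun k l => (X ^ ((l : ℕ) + 1) %ₘ f).coeff k

/-- A finite set of reals can be cut by a rational so that exactly `k` elements lie below it. -/
theorem exists_rat_card_filter_lt_eq (A : Finset ℝ) :
    ∀ b : ℝ, (∀ x ∈ A, x < b) → ∀ k ≤ A.card,
      ∃ q : ℚ, (q : ℝ) < b ∧ (q : ℝ) ∉ A ∧ (A.filter (· < (q : ℝ))).card = k := by
  induction A using Finset.induction_on_max with
  | empty =>
    intro b _ k hk
    obtain ⟨q, hq⟩ := exists_rat_lt b
    exact ⟨q, hq, by simp, by simpa using (Nat.le_zero.1 hk).symm⟩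
  | insert a s hs ih =>
    intro b hb k hk
    have ha : a ∉ s := fun h => lt_irrefl _ (hs a h)
    have hab : a < b := hb a (Finset.mem_insert_self _ _)
    rw [Finset.card_insert_of_notMem ha] at hk
    rcases Nat.le_succ_iff.1 hk with hk | rfl
    · obtain ⟨q, hqa, hqs, hq⟩ := ih a hs k hk
      refine ⟨q, hqa.trans hab, ?_, ?_⟩
      · rw [Finset.mem_insert, not_or]
        exact ⟨hqa.ne, hqs⟩
      · rw [Finset.filter_insert, if_neg hqa.not_gt, hq]
    · obtain ⟨q, haq, hqb⟩ := exists_rat_btwn hab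
      have hlt : ∀ x ∈ insert a s, x < (q : ℝ) := fun x hx => by
        rcases Finset.mem_insert.1 hx with rfl | hx
        · exact haq
        · exact (hs x hx).trans haq
      refine ⟨q, hqb, fun h => lt_irrefl _ (hlt _ h), ?_⟩
      rw [Finset.filter_true_of_mem hlt, Finset.card_insert_of_notMem ha]

theorem star_dotProduct_diagonal_mulVec {ι : Type*} [Fintype ι] [DecidableEq ι]
    (c : ι → ℝ) (y : ι → ℂ) :
    star y ⬝ᵥ (diagonal (fun i => (c i : ℂ)) *ᵥ y) =
      ((∑ i, c i * Complex.normSq (y i) : ℝ) : ℂ) := by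
  simp only [dotProduct, mulVec_diagonal, Pi.star_apply, Complex.ofReal_sum, Complex.ofReal_mul,
    Complex.normSq_eq_conj_mul_self]
  exact Finset.sum_congr rfl fun i _ => by rw [starRingEnd_apply]; ring

/-- If two real diagonal forms satisfy `l = Wᴴ c W`, then `l` has at most as many negative entries
as `c`. -/
theorem card_neg_le_of_diagonal_eq {ι : Type*} [Fintype ι] [DecidableEq ι] (l c : ι → ℝ)
    (W : Matrix ι ι ℂ)
    (h : diagonal (fun i => (l i : ℂ)) = Wᴴ * diagonal (fun i => (c i : ℂ)) * W) :
    (Finset.univ.filter fun i => l i < 0).card ≤ (Finset.univ.filter fun i => c i < 0).card := by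
  have key (y : ι → ℂ) :
      ∑ i, l i * Complex.normSq (y i) = ∑ i, c i * Complex.normSq ((W *ᵥ y) i) := by
    have h1 := star_dotProduct_diagonal_mulVec l y
    rw [h, ← mulVec_mulVec, ← mulVec_mulVec, dotProduct_mulVec, ← star_mulVec,
      star_dotProduct_diagonal_mulVec] at h1
    exact_mod_cast h1.symm
  let E := Function.ExtendByZero.linearMap ℂ (Subtype.val : {i // l i < 0} → ι)
  let R := LinearMap.funLeft ℂ ℂ (Subtype.val : {i // c i < 0} → ι)
  let T := R ∘ₗ W.mulVecLin ∘ₗ E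
  have hT : Function.Injective T := by
    rw [← LinearMap.ker_eq_bot, LinearMap.ker_eq_bot']
    intro y hy
    have hE (i : {i // l i < 0}) : E y i = y i :=
      Subtype.val_injective.extend_apply (y : {i // l i < 0} → ℂ) (0 : ι → ℂ) i
    have hE' (i : ι) (hi : ¬ l i < 0) : E y i = 0 :=
      Function.extend_apply' (y : {i // l i < 0} → ℂ) (0 : ι → ℂ) i fun ⟨a, ha⟩ => hi (ha ▸ a.2)
    have hneg : ∀ i ∈ Finset.univ, l i * Complex.normSq (E y i) ≤ 0 := fun i _ => by
      by_cases hi : l i < 0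
      · exact mul_nonpos_of_nonpos_of_nonneg hi.le (Complex.normSq_nonneg _)
      · simp [hE' i hi]
    have hpos : 0 ≤ ∑ i, c i * Complex.normSq ((W *ᵥ E y) i) :=
      Finset.sum_nonneg fun i _ => by
        by_cases hi : c i < 0
        · have : (W *ᵥ E y) i = 0 := congrFun hy ⟨i, hi⟩
          simp [this]
        · exact mul_nonneg (not_lt.1 hi) (Complex.normSq_nonneg _)
    have h0 := (Finset.sum_eq_zero_iff_of_nonpos hneg).1
      (le_antisymm (Finset.sum_nonpos hneg) (key (E y) ▸ hpos))
    funext i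
    have := (mul_eq_zero.1 (h0 i (Finset.mem_univ _))).resolve_left i.2.ne
    rw [← hE]
    exact Complex.normSq_eq_zero.1 this
  simpa [Fintype.card_subtype] using LinearMap.finrank_le_finrank_of_injective hT

/-- A form of **Sylvester's law of inertia**. -/
theorem Matrix.IsHermitian.card_eigenvalues_eq_of_map_eq {n : ℕ} {A : Matrix (Fin n) (Fin n) ℝ}
    (hA : A.IsHermitian) (V : Matrix (Fin n) (Fin n) ℂ) (c : Fin n → ℝ)
    (h : A.map (Complex.ofReal) = Vᴴ * diagonal (fun i => (c i : ℂ)) * V)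
    (hdet : A.det ≠ 0) (hc : ∀ i, c i ≠ 0) :
    (Finset.univ.filter fun i => hA.eigenvalues i < 0).card =
        (Finset.univ.filter fun i => c i < 0).card ∧
      (Finset.univ.filter fun i => 0 < hA.eigenvalues i).card =
        (Finset.univ.filter fun i => 0 < c i).card := by
  let U : Matrix (Fin n) (Fin n) ℝ := hA.eigenvectorUnitary
  have hU : diagonal hA.eigenvalues = Uᵀ * A * U := by
    have := hA.conjStarAlgAut_star_eigenvectorUnitary
    rw [Unitary.conjStarAlgAut_star_apply] at this
    exact this.symm
  let W := V * U.map Complex.ofReal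
  have hW : diagonal (fun i => (hA.eigenvalues i : ℂ)) =
      Wᴴ * diagonal (fun i => (c i : ℂ)) * W := by
    have h1 := congrArg (fun M : Matrix (Fin n) (Fin n) ℝ => M.map Complex.ofRealHom) hU
    simp only [Matrix.map_mul, diagonal_map (map_zero Complex.ofRealHom)] at h1
    have h2 : (U.map Complex.ofReal)ᴴ = Uᵀ.map Complex.ofReal := by
      ext i j
      simp
    simp only [W, conjTranspose_mul, h2]
    calc _ = _ := h1
      _ = Uᵀ.map Complex.ofReal * A.map Complex.ofReal * U.map Complex.ofReal := rfl
      _ = _ := by rw [h]; simp only [Matrix.mul_assoc]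
  have hl : ∀ i, hA.eigenvalues i ≠ 0 := fun i hi => hdet <| by
    rw [hA.det_eq_prod_eigenvalues]
    exact Finset.prod_eq_zero (Finset.mem_univ i) (by simp [hi])
  have hneg := card_neg_le_of_diagonal_eq _ _ W hW
  have hpos := card_neg_le_of_diagonal_eq (fun i => -hA.eigenvalues i) (fun i => -c i) W (by
    have hD (a : Fin n → ℝ) : diagonal (fun i => ((-a i : ℝ) : ℂ)) =
        -diagonal fun i => (a i : ℂ) := by
      simp only [Complex.ofReal_neg, diagonal_neg]
    rw [hD, hD, hW, Matrix.mul_neg, Matrix.neg_mul])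
  simp only [neg_lt_zero] at hpos
  have hcount (a : Fin n → ℝ) (ha : ∀ i, a i ≠ 0) : (Finset.univ.filter fun i => a i < 0).card +
      (Finset.univ.filter fun i => 0 < a i).card = n := by
    have : (Finset.univ.filter fun i => 0 < a i) = Finset.univ.filter fun i => ¬ a i < 0 :=
      Finset.filter_congr fun i _ => by
        rw [not_lt]
        exact ⟨le_of_lt, fun h => lt_of_le_of_ne h (ha i).symm⟩
    rw [this, Finset.card_filter_add_card_filter_not, Finset.card_univ, Fintype.card_fin]
  have h1 := hcount _ hl
  have h2 := hcount _ hc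
  omega

theorem Complex.conj_ne_self_of_isPrimitiveRoot {m : ℕ} (hm : 2 < m) {ζ : ℂ}
    (h : IsPrimitiveRoot ζ m) : starRingEnd ℂ ζ ≠ ζ := fun hc => by
  have h1 : ζ * ζ = 1 := by
    nth_rewrite 2 [← hc]
    rw [Complex.mul_conj, Complex.normSq_eq_norm_sq, h.norm'_eq_one (by omega)]
    simp
  have := Nat.le_of_dvd two_pos (h.dvd_of_pow_eq_one 2 (by rw [sq, h1]))
  omega

/-- Real parts of primitive `m`-th roots of unity, `m > 2`, are attained exactly twice. -/
theorem Complex.card_filter_primitiveRoots_re_eq_two {m : ℕ} (hm : 2 < m) {ζ : ℂ}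
    (h : IsPrimitiveRoot ζ m) :
    ((primitiveRoots m ℂ).filter fun w => 2 * w.re = 2 * ζ.re).card = 2 := by
  have hm0 : 0 < m := by omega
  have hconj : IsPrimitiveRoot (starRingEnd ℂ ζ) m :=
    h.map_of_injective (starRingEnd ℂ).injective
  have : ((primitiveRoots m ℂ).filter fun w => 2 * w.re = 2 * ζ.re) = {ζ, starRingEnd ℂ ζ} := by
    ext w
    simp only [Finset.mem_filter, mem_primitiveRoots hm0, Finset.mem_insert,
      Finset.mem_singleton]
    constructor
    · rintro ⟨hw, hre⟩
      have hre : w.re = ζ.re := by linarith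
      have h1 : Complex.normSq w = Complex.normSq ζ := by
        rw [Complex.normSq_eq_norm_sq, Complex.normSq_eq_norm_sq, h.norm'_eq_one hm0.ne',
          hw.norm'_eq_one hm0.ne']
      rw [Complex.normSq_apply, Complex.normSq_apply, hre, add_right_inj] at h1
      rcases mul_self_eq_mul_self_iff.1 h1 with h2 | h2
      · exact Or.inl (Complex.ext hre h2)
      · exact Or.inr (Complex.ext (by simpa using hre) (by simpa using h2))
    · rintro (rfl | rfl)
      · exact ⟨h, rfl⟩
      · exact ⟨hconj, by simp⟩
  rw [this, Finset.card_pair (conj_ne_self_of_isPrimitiveRoot hm h).symm]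

theorem exists_rat_card_filter_primitiveRoots_eq {r m : ℕ} (hr : Even r) (hm : 2 < m)
    (hrm : r ≤ m.totient) :
    ∃ q : ℚ, (∀ w ∈ primitiveRoots m ℂ, 2 * w.re ≠ (q : ℝ)) ∧
      ((primitiveRoots m ℂ).filter fun w => 2 * w.re < (q : ℝ)).card = r := by
  let S := primitiveRoots m ℂ
  let f : ℂ → ℝ := fun w => 2 * w.re
  have hfib : ∀ a ∈ S.image f, (S.filter fun w => f w = a).card = 2 := fun a ha => by
    obtain ⟨ζ, hζ, rfl⟩ := Finset.mem_image.1 ha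
    exact Complex.card_filter_primitiveRoots_re_eq_two hm (isPrimitiveRoot_of_mem_primitiveRoots hζ)
  have hS : m.totient = 2 * (S.image f).card := by
    rw [← Complex.card_primitiveRoots, Finset.card_eq_sum_card_image f,
      Finset.sum_congr rfl hfib, Finset.sum_const, smul_eq_mul, mul_comm]
  obtain ⟨k, rfl⟩ := hr
  obtain ⟨b, hb⟩ := (S.image f).exists_le
  obtain ⟨q, -, hqS, hq⟩ := exists_rat_card_filter_lt_eq (S.image f) (b + 1)
    (fun x hx => (hb x hx).trans_lt (lt_add_one b)) k (by omega)
  refine ⟨q, fun w hw h => hqS (Finset.mem_image.2 ⟨w, hw, h⟩), ?_⟩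
  have himg : (S.filter fun w => f w < q).image f = (S.image f).filter (· < (q : ℝ)) :=
    (Finset.filter_image (p := (· < (q : ℝ)))).symm
  change (S.filter fun w => f w < q).card = _
  rw [Finset.card_eq_sum_card_image f, himg, Finset.sum_congr rfl (g := fun _ => 2),
    Finset.sum_const, hq, smul_eq_mul, mul_two]
  intro a ha
  obtain ⟨ha, haq⟩ := Finset.mem_filter.1 ha
  rw [← hfib a ha, Finset.filter_filter]
  congr 1
  exact Finset.filter_congr fun w _ => ⟨And.right, fun h => ⟨h ▸ haq, h⟩⟩

theorem vandermonde_mul_mulXModMatrix {n : ℕ} {f : ℤ[X]} (hf : f.Monic) (hn : f.natDegree = n)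
    (hf1 : f ≠ 1) (z : Fin n → ℂ) (hz : ∀ j, aeval (z j) f = 0) :
    vandermonde z * (mulXModMatrix n f).map (Int.castRingHom ℂ) = diagonal z * vandermonde z := by
  ext j l
  have hdeg : (X ^ ((l : ℕ) + 1) %ₘ f).natDegree < n := (natDegree_modByMonic_lt _ hf hf1).trans_eq hn
  have h1 : aeval (z j) (X ^ ((l : ℕ) + 1) %ₘ f) = z j ^ ((l : ℕ) + 1) := by
    have := congrArg (aeval (z j)) (modByMonic_add_div (X ^ ((l : ℕ) + 1)) f)
    simpa [hz j] using this
  rw [aeval_def, eval₂_eq_sum_range' _ hdeg, Finset.sum_range] at h1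
  rw [diagonal_mul, vandermonde_apply, ← pow_succ', ← h1, mul_apply]
  exact Finset.sum_congr rfl fun k _ => by simp [mulXModMatrix, mul_comm]

/-- The Gram matrix of `Tr (2 (b (ζ + ζ⁻¹) - a) x̄ y)`, where `t e` stands for the trace of
`ζ ^ e`. -/
def traceGramMatrix (m n : ℕ) (t : ℕ → ℤ) (a b : ℤ) : Matrix (Fin n) (Fin n) ℤ :=
  Matrix.of fun k l => 2 * (b * (t (l + (m - 1) * k + 1) + t (l + (m - 1) * k + (m - 1))) -
    a * t (l + (m - 1) * k))

theorem map_traceGramMatrix {m n : ℕ} (hm : 0 < m) {t : ℕ → ℤ} (a b : ℤ) {z : Fin n → ℂ}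
    (hz : ∀ j, IsPrimitiveRoot (z j) m) (ht : ∀ e, (t e : ℂ) = ∑ j, z j ^ e) :
    (traceGramMatrix m n t a b).map (Int.castRingHom ℂ) = (vandermonde z)ᴴ *
      diagonal (fun j => ((2 * (b * (2 * (z j).re) - a) : ℝ) : ℂ)) * vandermonde z := by
  have hconj (j : Fin n) : starRingEnd ℂ (z j) = z j ^ (m - 1) := by
    rw [← Complex.inv_eq_conj ((hz j).norm'_eq_one hm.ne')]
    refine inv_eq_of_mul_eq_one_right ?_
    rw [← pow_succ', Nat.sub_add_cancel hm, (hz j).pow_eq_one]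
  ext k l
  rw [Matrix.mul_assoc, mul_apply]
  simp only [traceGramMatrix, map_apply, of_apply, eq_intCast, Int.cast_mul, Int.cast_sub,
    Int.cast_add, ht, Int.cast_ofNat, diagonal_mul, conjTranspose_apply, vandermonde_apply]
  rw [← Finset.sum_add_distrib, Finset.mul_sum, Finset.mul_sum, ← Finset.sum_sub_distrib,
    Finset.mul_sum]
  refine Finset.sum_congr rfl fun j _ => ?_
  have hre : ((2 * (z j).re : ℝ) : ℂ) = z j + z j ^ (m - 1) := by
    rw [← hconj, Complex.add_conj]
  rw [Complex.ofReal_mul, Complex.ofReal_sub, Complex.ofReal_mul, hre, star_pow,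
    ← starRingEnd_apply, hconj]
  push_cast
  ring

/-- Let `r, s` be even non-negative integers and `m > 1` with
`r + s = φ(m)`. Then there exist a `φ(m) × φ(m)` symmetric integer matrix `G` with even
diagonal, `det G ≠ 0`, and signature `(r, s)`, and an integer matrix `θ` with
characteristic polynomial `Φ_m` and `θᵀ G θ = G`. -/
theorem exists_even_lattice_with_cyclotomic_isometry
    (r s m : ℕ) (hr : Even r) (hs : Even s) (hm : 1 < m)
    (hrs : r + s = m.totient) :
    ∃ G θ : Matrix (Fin m.totient) (Fin m.totient) ℤ,
      G.transpose = G ∧ (∀ i, Even (G i i)) ∧ G.det ≠ 0 ∧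
      (∃ hH : (G.map (Int.cast : ℤ → ℝ)).IsHermitian,
        (Finset.univ.filter fun i => hH.eigenvalues i < 0).card = r ∧
        (Finset.univ.filter fun i => 0 < hH.eigenvalues i).card = s) ∧
      θ.charpoly = Polynomial.cyclotomic m ℤ ∧ θ.transpose * G * θ = G := by
  have hm2 : 2 < m := by
    by_contra! h
    obtain rfl : m = 2 := by omega
    rw [Nat.totient_two] at hrs
    have := hrs ▸ hr.add hs
    exact absurd this (by decide)
  have hm0 : 0 < m := by omega
  obtain ⟨q, hq, hqr⟩ := exists_rat_card_filter_primitiveRoots_eq hr hm2 (by omega)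
  let e := (Finset.equivFinOfCardEq (Complex.card_primitiveRoots m)).symm
  let z : Fin m.totient → ℂ := fun j => e j
  have hzinj : Function.Injective z := Subtype.val_injective.comp e.injective
  have hz (j) : IsPrimitiveRoot (z j) m := isPrimitiveRoot_of_mem_primitiveRoots (e j).2
  have himg : Finset.univ.map ⟨z, hzinj⟩ = primitiveRoots m ℂ := by
    ext w
    simp only [Finset.mem_map, Finset.mem_univ, true_and, Function.Embedding.coeFn_mk]
    exact ⟨fun ⟨j, hj⟩ => hj ▸ (e j).2, fun hw => ⟨e.symm ⟨w, hw⟩, by simp [z]⟩⟩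
  let V := vandermonde z
  have hV : V.det ≠ 0 := det_vandermonde_ne_zero_iff.2 hzinj
  let θ := mulXModMatrix m.totient (cyclotomic m ℤ)
  let θc := θ.map (Int.castRingHom ℂ)
  have hVθ : V * θc = diagonal z * V :=
    vandermonde_mul_mulXModMatrix (cyclotomic.monic m ℤ) (natDegree_cyclotomic m ℤ)
      (fun h => by
        have := congrArg natDegree h
        rw [natDegree_cyclotomic, natDegree_one] at this
        exact (Nat.totient_pos.2 hm0).ne' this) z fun j => by
      rw [aeval_def, eval₂_eq_eval_map, algebraMap_int_eq, map_cyclotomic]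
      exact (hz j).isRoot_cyclotomic hm0
  obtain ⟨u, hu⟩ : IsUnit V := (isUnit_iff_isUnit_det V).2 hV.isUnit
  have hθc : θc = (↑u⁻¹ : Matrix _ _ ℂ) * diagonal z * (u : Matrix _ _ ℂ) := by
    rw [Matrix.mul_assoc, hu, ← hVθ, ← hu, Units.inv_mul_cancel_left]
  have htr (k : ℕ) : ((θ ^ k).trace : ℂ) = ∑ j, z j ^ k := by
    have h1 : (((θ ^ k).trace : ℤ) : ℂ) = (θc ^ k).trace := by
      rw [← Matrix.map_pow]
      exact AddMonoidHom.map_trace (Int.castRingHom ℂ).toAddMonoidHom (θ ^ k)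
    have h2 : θc ^ k = (↑u⁻¹ : Matrix _ _ ℂ) * diagonal z ^ k * (u : Matrix _ _ ℂ) := by
      rw [hθc, Units.conj_pow']
    rw [h1, h2, trace_units_conj', diagonal_pow, trace_diagonal]
    rfl
  let c : Fin m.totient → ℝ := fun j => 2 * (q.den * (2 * (z j).re) - q.num)
  let D := diagonal fun j => (c j : ℂ)
  let G := traceGramMatrix m m.totient (fun k => (θ ^ k).trace) q.num q.den
  have hG : G.map (Int.castRingHom ℂ) = Vᴴ * D * V := by
    rw [map_traceGramMatrix hm0 q.num q.den hz htr]
    simp only [V, D, c, Int.cast_natCast]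
  have hinj : Function.Injective fun M : Matrix (Fin m.totient) (Fin m.totient) ℤ =>
    M.map (Int.castRingHom ℂ) := Matrix.map_injective Int.cast_injective
  have hstar (M : Matrix (Fin m.totient) (Fin m.totient) ℤ) :
      Mᵀ.map (Int.castRingHom ℂ) = (M.map (Int.castRingHom ℂ))ᴴ := by
    ext
    simp
  have hcq (j) : c j = 2 * q.den * (2 * (z j).re - q) := by
    have : (q : ℝ) * q.den = q.num := by exact_mod_cast q.mul_den_eq_num
    simp only [c, ← this]
    ring
  have hc (j) : c j ≠ 0 := by
    rw [hcq]
    exact mul_ne_zero (by positivity) (sub_ne_zero.2 (hq _ (e j).2))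
  have hcr : (Finset.univ.filter fun j => c j < 0).card = r := by
    rw [← hqr, ← himg, Finset.filter_map, Finset.card_map]
    congr 1
    refine Finset.filter_congr fun j _ => ?_
    rw [hcq, ← mul_zero (2 * (q.den : ℝ)), mul_lt_mul_iff_right₀ (by positivity), sub_neg]
    rfl
  have hcs : (Finset.univ.filter fun j => 0 < c j).card = s := by
    have h1 := Finset.card_filter_add_card_filter_not (s := Finset.univ) fun j => c j < 0
    have h2 : (Finset.univ.filter fun j => ¬ c j < 0) = Finset.univ.filter fun j => 0 < c j :=
      Finset.filter_congr fun j _ => by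
        rw [not_lt]
        exact ⟨fun h => lt_of_le_of_ne h (hc j).symm, le_of_lt⟩
    rw [h2, hcr, Finset.card_univ, Fintype.card_fin] at h1
    omega
  have hsymm : Gᵀ = G := hinj <| by
    have hD : Dᴴ = D := by
      ext i j
      by_cases h : i = j
      · simp [D, h]
      · simp [D, h, Ne.symm h]
    simp only [hstar, hG, conjTranspose_mul, conjTranspose_conjTranspose, hD, Matrix.mul_assoc]
  have hdet : G.det ≠ 0 := fun h => by
    have h1 : (G.map (Int.castRingHom ℂ)).det = 0 := by
      rw [← RingHom.mapMatrix_apply, ← RingHom.map_det, h, map_zero]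
    rw [hG, det_mul, det_mul, det_conjTranspose, det_diagonal] at h1
    refine mul_ne_zero (mul_ne_zero (star_ne_zero.2 hV) ?_) hV h1
    exact Finset.prod_ne_zero_iff.2 fun j _ => Complex.ofReal_ne_zero.2 (hc j)
  have hH : (G.map (Int.cast : ℤ → ℝ)).IsHermitian := by
    ext i j
    have := congrFun (congrFun hsymm i) j
    simpa using this
  refine ⟨G, θ, hsymm, fun i => ?_, hdet, ⟨hH, ?_⟩, ?_, ?_⟩
  · exact even_two_mul _
  · have := hH.card_eigenvalues_eq_of_map_eq V c (by
      rw [← hG]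
      ext
      simp) (by
        have : (G.map (Int.cast : ℤ → ℝ)).det = (G.det : ℝ) :=
          ((Int.castRingHom ℝ).map_det G).symm
        rw [this]
        exact_mod_cast hdet) hc
    rwa [hcr, hcs] at this
  · apply Polynomial.map_injective (Int.castRingHom ℂ) Int.cast_injective
    rw [← Matrix.charpoly_map, map_cyclotomic]
    change θc.charpoly = _
    rw [hθc, coe_units_inv, charpoly_units_conj', charpoly_diagonal,
      cyclotomic_eq_prod_X_sub_primitiveRoots (Complex.isPrimitiveRoot_exp m hm0.ne'), ← himg,
      Finset.prod_map]
    rfl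
  · apply hinj
    have hD : (diagonal z)ᴴ * D * diagonal z = D := by
      rw [diagonal_conjTranspose, diagonal_mul_diagonal, diagonal_mul_diagonal]
      congr 1
      funext j
      have : star (z j) * z j = 1 := by
        rw [← starRingEnd_apply, ← Complex.normSq_eq_conj_mul_self, Complex.normSq_eq_norm_sq,
          (hz j).norm'_eq_one hm0.ne']
        simp
      rw [Pi.star_apply, mul_right_comm, this, one_mul]
    calc (θᵀ * G * θ).map (Int.castRingHom ℂ) = θcᴴ * (Vᴴ * D * V) * θc := by
          rw [Matrix.map_mul, Matrix.map_mul, hstar, hG]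
      _ = (V * θc)ᴴ * D * (V * θc) := by
          simp only [conjTranspose_mul, Matrix.mul_assoc]
      _ = Vᴴ * ((diagonal z)ᴴ * D * diagonal z) * V := by
          rw [hVθ]
          simp only [conjTranspose_mul, Matrix.mul_assoc]
      _ = G.map (Int.castRingHom ℂ) := by rw [hD, hG]
end

section
/- Let r and s be even non-negative integers, let n = r + s, and let θ ∈ GL(n,ℤ) be an integer matrix of finite multiplicative order. Then there exists an n×n symmetric integer matrix G with every diagonal entry even, det G ≠ 0, and signature (r, s), such that θᵀ G θ = G; i.e. every finite-order element of GL(n,ℤ) is an isometric automorphism of some even nondegenerate lattice of any prescribed even signature (r, s) with r + s = n. -/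
open Module in
/-- A subspace on which a diagonalised form is negative definite has dimension at most the number
of negative coefficients. -/
lemma Submodule.finrank_le_card_neg_of_sum_sq_neg {ι V : Type*} [Fintype ι] [AddCommGroup V]
    [Module ℝ V] [FiniteDimensional ℝ V] (w : ι → ℝ) (c : V →ₗ[ℝ] (ι → ℝ)) (U : Submodule ℝ V)
    (hU : ∀ x ∈ U, x ≠ 0 → ∑ i, w i * c x i ^ 2 < 0) :
    finrank ℝ U ≤ (Finset.univ.filter fun i => w i < 0).card := by
  let f : U →ₗ[ℝ] ({i // w i < 0} → ℝ) :=
    (LinearMap.funLeft ℝ ℝ Subtype.val).comp (c.comp U.subtype)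
  have hf : Function.Injective f := by
    rw [injective_iff_map_eq_zero]
    intro x hx
    by_contra hne
    have h := hU x x.2 (by simpa using hne)
    refine h.not_ge (Finset.sum_nonneg fun i _ => ?_)
    by_cases hi : w i < 0
    · have : c x i = 0 := congrFun hx ⟨i, hi⟩
      simp [this]
    · exact mul_nonneg (not_lt.mp hi) (sq_nonneg _)
  simpa [Fintype.card_subtype] using LinearMap.finrank_le_finrank_of_injective hf

open Matrix in
lemma Matrix.IsHermitian.dotProduct_mulVec_eq_sum_eigenvalues {ι : Type*} [Fintype ι]
    [DecidableEq ι] {H : Matrix ι ι ℝ} (hH : H.IsHermitian) (x : ι → ℝ) :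
    x ⬝ᵥ H *ᵥ x = ∑ i, hH.eigenvalues i *
      ((star (hH.eigenvectorUnitary : Matrix ι ι ℝ)) *ᵥ x) i ^ 2 := by
  set P : Matrix ι ι ℝ := (hH.eigenvectorUnitary : Matrix ι ι ℝ)
  have hP : H = P * diagonal hH.eigenvalues * star P := by
    simpa [Unitary.conjStarAlgAut_apply] using hH.spectral_theorem
  have hx : x ᵥ* P = star P *ᵥ x := by
    rw [star_eq_conjTranspose, conjTranspose_eq_transpose_of_trivial, mulVec_transpose]
  conv_lhs => rw [hP]
  rw [← mulVec_mulVec, ← mulVec_mulVec, dotProduct_mulVec, hx]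
  simp only [dotProduct, mulVec_diagonal]
  exact Finset.sum_congr rfl fun i _ => by ring

open Module Matrix in
/-- A real symmetric matrix that is negative and positive definite on subspaces of complementary
dimensions is nondegenerate, and these dimensions are its signature. -/
lemma Matrix.IsHermitian.signature_of_definite_subspaces {ι : Type*} [Fintype ι] [DecidableEq ι]
    {H : Matrix ι ι ℝ} (hH : H.IsHermitian) {U W : Submodule ℝ (ι → ℝ)}
    (hUW : Fintype.card ι = finrank ℝ U + finrank ℝ W)
    (hU : ∀ x ∈ U, x ≠ 0 → x ⬝ᵥ H *ᵥ x < 0) (hW : ∀ x ∈ W, x ≠ 0 → 0 < x ⬝ᵥ H *ᵥ x) :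
    H.det ≠ 0 ∧ (Finset.univ.filter fun i => hH.eigenvalues i < 0).card = finrank ℝ U ∧
      (Finset.univ.filter fun i => 0 < hH.eigenvalues i).card = finrank ℝ W := by
  let c : (ι → ℝ) →ₗ[ℝ] (ι → ℝ) :=
    Matrix.mulVecLin (star (hH.eigenvectorUnitary : Matrix ι ι ℝ))
  have hneg := Submodule.finrank_le_card_neg_of_sum_sq_neg hH.eigenvalues c U fun x hx h0 => by
    simpa [c, hH.dotProduct_mulVec_eq_sum_eigenvalues] using hU x hx h0
  have hpos := Submodule.finrank_le_card_neg_of_sum_sq_neg (-hH.eigenvalues) c W fun x hx h0 => by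
    simpa [c, hH.dotProduct_mulVec_eq_sum_eigenvalues] using hW x hx h0
  simp only [Pi.neg_apply, neg_lt_zero] at hpos
  have hdisj : Disjoint (Finset.univ.filter fun i => hH.eigenvalues i < 0)
      (Finset.univ.filter fun i => 0 < hH.eigenvalues i) :=
    Finset.disjoint_filter.mpr fun i _ h => h.le.not_gt
  have hcard := Finset.card_union_of_disjoint hdisj
  have hle := Finset.card_le_univ ((Finset.univ.filter fun i => hH.eigenvalues i < 0) ∪
    (Finset.univ.filter fun i => 0 < hH.eigenvalues i))
  refine ⟨?_, by omega, by omega⟩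
  have huniv := (Finset.card_eq_iff_eq_univ _).mp (le_antisymm hle (by omega))
  rw [hH.det_eq_prod_eigenvalues]
  refine Finset.prod_ne_zero_iff.mpr fun i _ => ?_
  have hi := Finset.mem_univ i
  rw [← huniv] at hi
  simp only [Finset.mem_union, Finset.mem_filter, Finset.mem_univ, true_and] at hi
  simpa using hi.elim ne_of_lt ne_of_gt

section Isometry

open Module

variable {E : Type*} [NormedAddCommGroup E] [InnerProductSpace ℝ E] [FiniteDimensional ℝ E]

lemma LinearMap.map_mem_orthogonal_of_isometry {T : E →ₗ[ℝ] E}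
    (hT : ∀ x y, inner ℝ (T x) (T y) = inner ℝ x y) {P : Submodule ℝ E} (hP : ∀ x ∈ P, T x ∈ P)
    {x : E} (hx : x ∈ Pᗮ) : T x ∈ Pᗮ := by
  have hinj : Function.Injective (T.restrict hP) := by
    rw [injective_iff_map_eq_zero]
    intro y hy
    have hy' : T y = 0 := congrArg Subtype.val hy
    have := hT y y
    rw [hy', inner_zero_left, eq_comm, inner_self_eq_zero] at this
    exact Subtype.ext this
  intro y hy
  obtain ⟨z, hz⟩ := LinearMap.injective_iff_surjective.mp hinj ⟨y, hy⟩
  have hz' : T z = y := congrArg Subtype.val hz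
  rw [← hz', hT]
  exact hx z z.2

lemma LinearMap.exists_invariant_finrank_add {T : E →ₗ[ℝ] E}
    (hT : ∀ x y, inner ℝ (T x) (T y) = inner ℝ x y) {P : Submodule ℝ E} (hP : ∀ x ∈ P, T x ∈ P)
    {d : ℕ} (h : ∃ Q : Submodule ℝ Pᗮ,
      (∀ x ∈ Q, T.restrict (fun _ => T.map_mem_orthogonal_of_isometry hT hP) x ∈ Q) ∧
        finrank ℝ Q = d) :
    ∃ U : Submodule ℝ E, (∀ x ∈ U, T x ∈ U) ∧ finrank ℝ U = finrank ℝ P + d := by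
  obtain ⟨Q, hQ, rfl⟩ := h
  refine ⟨P ⊔ Q.map Pᗮ.subtype, ?_, ?_⟩
  · intro x hx
    obtain ⟨y, hy, z, ⟨z, hz, rfl⟩, rfl⟩ := Submodule.mem_sup.mp hx
    rw [map_add]
    exact Submodule.add_mem_sup (hP y hy) ⟨_, hQ z hz, rfl⟩
  · have hdisj : P ⊓ Q.map Pᗮ.subtype = ⊥ :=
      eq_bot_mono (inf_le_inf_left P (Submodule.map_subtype_le _ _)) P.inf_orthogonal_eq_bot
    have := Submodule.finrank_sup_add_finrank_inf_eq P (Q.map Pᗮ.subtype)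
    rw [hdisj, finrank_bot, add_zero, Submodule.finrank_map_subtype_eq] at this
    exact this

lemma LinearMap.exists_invariant_finrank_one_or_two [Nontrivial E] {T : E →ₗ[ℝ] E}
    (hT : ∀ x y, inner ℝ (T x) (T y) = inner ℝ x y) :
    ∃ P : Submodule ℝ E, (∀ x ∈ P, T x ∈ P) ∧ (finrank ℝ P = 1 ∨ finrank ℝ P = 2) := by
  have hadj : ∀ x, T.adjoint (T x) = x := fun x => ext_inner_right ℝ fun y => by
    rw [LinearMap.adjoint_inner_left, hT]
  have hsymm : (T + T.adjoint).IsSymmetric := fun x y => by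
    simp only [LinearMap.add_apply, inner_add_left, inner_add_right, LinearMap.adjoint_inner_left,
      LinearMap.adjoint_inner_right]
    ring
  obtain ⟨v, hv⟩ := hsymm.hasEigenvalue_iSup_of_finiteDimensional.exists_hasEigenvector
  set μ : ℝ := _
  have hv1 : T v + T.adjoint v = μ • v := hv.apply_eq_smul
  have hinv : T (T.adjoint v) = v :=
    LinearMap.congr_fun (mul_eq_one_comm.mp (LinearMap.ext hadj : T.adjoint * T = 1)) v
  refine ⟨Submodule.span ℝ {v, T v}, fun x hx => ?_, ?_⟩
  · obtain ⟨a, b, rfl⟩ := Submodule.mem_span_pair.mp hx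
    refine Submodule.mem_span_pair.mpr ⟨-b, a + b * μ, ?_⟩
    have h2 : T (T v) = μ • T v - v := by
      rw [← map_smul, ← hv1, map_add, hinv, add_sub_cancel_right]
    rw [map_add, map_smul, map_smul, h2]
    module
  · have hle : finrank ℝ (Submodule.span ℝ {v, T v}) ≤ 2 := by
      classical
      refine (finrank_span_le_card ({v, T v} : Set E)).trans ?_
      simpa using Finset.card_le_two
    have hpos : 0 < finrank ℝ (Submodule.span ℝ {v, T v}) :=
      Submodule.one_le_finrank_iff.mpr fun h =>
        hv.2 ((Submodule.span_eq_bot.mp h) v (by simp))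
    omega

lemma LinearMap.exists_invariant_finrank_two {T : E →ₗ[ℝ] E}
    (hT : ∀ x y, inner ℝ (T x) (T y) = inner ℝ x y) (hE : 2 ≤ finrank ℝ E) :
    ∃ P : Submodule ℝ E, (∀ x ∈ P, T x ∈ P) ∧ finrank ℝ P = 2 := by
  have : Nontrivial E := finrank_pos_iff.mp (by omega : 0 < finrank ℝ E)
  obtain ⟨P, hP, h1 | h2⟩ := T.exists_invariant_finrank_one_or_two hT
  · have hsum := P.finrank_add_finrank_orthogonal
    have : Nontrivial Pᗮ := finrank_pos_iff.mp (by omega : 0 < finrank ℝ Pᗮ)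
    obtain ⟨Q, hQ, h⟩ := LinearMap.exists_invariant_finrank_one_or_two
      (T := T.restrict fun _ => T.map_mem_orthogonal_of_isometry hT hP) fun x y => hT x y
    rcases h with h | h
    · obtain ⟨U, hU, hd⟩ := T.exists_invariant_finrank_add hT hP ⟨Q, hQ, h⟩
      exact ⟨U, hU, by omega⟩
    · refine ⟨Q.map Pᗮ.subtype, ?_, by rw [Submodule.finrank_map_subtype_eq, h]⟩
      rintro _ ⟨z, hz, rfl⟩
      exact ⟨_, hQ z hz, rfl⟩
  · exact ⟨P, hP, h2⟩

/-- A linear isometry has invariant subspaces of every even dimension. -/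
lemma LinearMap.exists_invariant_finrank_two_mul {E : Type*} [NormedAddCommGroup E]
    [InnerProductSpace ℝ E] [FiniteDimensional ℝ E] {T : E →ₗ[ℝ] E}
    (hT : ∀ x y, inner ℝ (T x) (T y) = inner ℝ x y) (k : ℕ) (hk : 2 * k ≤ finrank ℝ E) :
    ∃ U : Submodule ℝ E, (∀ x ∈ U, T x ∈ U) ∧ finrank ℝ U = 2 * k := by
  induction k generalizing E with
  | zero => exact ⟨⊥, by simp, by simp⟩
  | succ k ih =>
    obtain ⟨P, hP, h2⟩ := T.exists_invariant_finrank_two hT (by omega)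
    have hsum := P.finrank_add_finrank_orthogonal
    obtain ⟨U, hU, hd⟩ := T.exists_invariant_finrank_add hT hP
      (ih (T := T.restrict fun _ => T.map_mem_orthogonal_of_isometry hT hP)
        (fun x y => hT x y) (by omega))
    exact ⟨U, hU, by omega⟩

/-- A linear isometry preserves symmetric bilinear forms of every signature with an even number of
negative squares. -/
lemma LinearMap.exists_invariant_bilinForm {T : E →ₗ[ℝ] E}
    (hT : ∀ x y, inner ℝ (T x) (T y) = inner ℝ x y) {k s : ℕ} (hE : finrank ℝ E = 2 * k + s) :
    ∃ (b : LinearMap.BilinForm ℝ E) (U W : Submodule ℝ E),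
      (∀ x y, b x y = b y x) ∧ (∀ x y, b (T x) (T y) = b x y) ∧
      finrank ℝ U = 2 * k ∧ finrank ℝ W = s ∧
      (∀ x ∈ U, x ≠ 0 → b x x < 0) ∧ (∀ x ∈ W, x ≠ 0 → 0 < b x x) := by
  obtain ⟨U, hU, hd⟩ := T.exists_invariant_finrank_two_mul hT k (by omega)
  have hsum := U.finrank_add_finrank_orthogonal
  have hcomm : ∀ x, Uᗮ.reflection (T x) = T (Uᗮ.reflection x) := fun x => by
    obtain ⟨y, hy, z, hz, rfl⟩ := U.exists_add_mem_mem_orthogonal x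
    simp only [map_add]
    rw [Submodule.reflection_mem_subspace_eq_self hz,
      Submodule.reflection_mem_subspace_eq_self (T.map_mem_orthogonal_of_isometry hT hU hz),
      Submodule.reflection_mem_subspace_orthogonal_precomplement_eq_neg hy,
      Submodule.reflection_mem_subspace_orthogonal_precomplement_eq_neg (hU y hy), map_neg]
  refine ⟨(innerₗ E).compl₂ (Uᗮ.reflection.toLinearEquiv : E →ₗ[ℝ] E), U, Uᗮ, ?_, ?_, hd,
    by omega, ?_, ?_⟩
  · intro x y
    have := Uᗮ.reflection.inner_map_map x (Uᗮ.reflection y)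
    rw [Submodule.reflection_reflection] at this
    simpa [real_inner_comm] using this.symm
  · intro x y
    simp [hcomm, hT]
  · intro x hx h0
    simpa [Submodule.reflection_mem_subspace_orthogonal_precomplement_eq_neg hx, sq_pos_iff]
      using h0
  · intro x hx h0
    simpa [Submodule.reflection_mem_subspace_eq_self hx, sq_pos_iff] using h0

end Isometry

open Matrix in
lemma Matrix.transpose_mul_sum_pow_mul {ι R : Type*} [Fintype ι] [DecidableEq ι] [CommRing R]
    {A : Matrix ι ι R} {m : ℕ} (hA : A ^ m = 1) (N : Matrix ι ι R) :
    Aᵀ * (∑ j ∈ Finset.range m, (A ^ j)ᵀ * N * A ^ j) * A =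
      ∑ j ∈ Finset.range m, (A ^ j)ᵀ * N * A ^ j := by
  have h1 := Finset.sum_range_succ (fun j => (A ^ j)ᵀ * N * A ^ j) m
  have h2 := Finset.sum_range_succ' (fun j => (A ^ j)ᵀ * N * A ^ j) m
  rw [h1, hA, pow_zero, add_left_inj] at h2
  rw [Finset.mul_sum, Finset.sum_mul, h2]
  refine Finset.sum_congr rfl fun j _ => ?_
  rw [pow_succ, transpose_mul]
  simp only [Matrix.mul_assoc]

open Matrix in
lemma Matrix.transpose_sum_pow_mul {ι R : Type*} [Fintype ι] [DecidableEq ι] [CommRing R]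
    (A : Matrix ι ι R) (m : ℕ) {N : Matrix ι ι R} (hN : Nᵀ = N) :
    (∑ j ∈ Finset.range m, (A ^ j)ᵀ * N * A ^ j)ᵀ =
      ∑ j ∈ Finset.range m, (A ^ j)ᵀ * N * A ^ j := by
  rw [transpose_sum]
  refine Finset.sum_congr rfl fun j _ => ?_
  rw [transpose_mul, transpose_mul, transpose_transpose, hN, Matrix.mul_assoc]

open Matrix in
lemma Matrix.mulVec_dotProduct_mulVec_mulVec {ι R : Type*} [Fintype ι] [CommRing R]
    (A N : Matrix ι ι R) (x y : ι → R) :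
    (A *ᵥ x) ⬝ᵥ N *ᵥ (A *ᵥ y) = x ⬝ᵥ (Aᵀ * N * A) *ᵥ y := by
  rw [← mulVec_mulVec, ← mulVec_mulVec, dotProduct_mulVec x, vecMul_transpose]

open Module Matrix in
/-- A real matrix of finite order preserves symmetric forms of every signature with an even number
of negative squares. -/
lemma Matrix.exists_invariant_form_of_pow_eq_one {ι : Type*} [Fintype ι] [DecidableEq ι]
    {A : Matrix ι ι ℝ} {m : ℕ} (hm : 0 < m) (hA : A ^ m = 1) {k s : ℕ}
    (hι : Fintype.card ι = 2 * k + s) :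
    ∃ (M : Matrix ι ι ℝ) (U W : Submodule ℝ (ι → ℝ)), M.IsSymm ∧ Aᵀ * M * A = M ∧
      finrank ℝ U = 2 * k ∧ finrank ℝ W = s ∧
      (∀ x ∈ U, x ≠ 0 → x ⬝ᵥ M *ᵥ x < 0) ∧ (∀ x ∈ W, x ≠ 0 → 0 < x ⬝ᵥ M *ᵥ x) := by
  set B : Matrix ι ι ℝ := ∑ j ∈ Finset.range m, (A ^ j)ᵀ * 1 * A ^ j with hB
  have hBA : Aᵀ * B * A = B := transpose_mul_sum_pow_mul hA 1
  have hBpos : B.PosDef := by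
    obtain ⟨l, rfl⟩ := Nat.exists_eq_succ_of_ne_zero hm.ne'
    rw [hB, Finset.sum_range_succ']
    refine PosDef.posSemidef_add (posSemidef_sum _ fun j _ => ?_) ?_
    · simpa using posSemidef_conjTranspose_mul_self (A ^ (j + 1))
    · simpa using PosDef.one
  let := B.toNormedAddCommGroup hBpos
  let := B.toInnerProductSpace hBpos.posSemidef
  have hinner : ∀ x y : ι → ℝ, inner ℝ x y = x ⬝ᵥ B *ᵥ y := fun x y => dotProduct_comm _ _
  obtain ⟨b, U, W, hsymm, hinv, hU, hW, hbU, hbW⟩ :=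
    LinearMap.exists_invariant_bilinForm (E := ι → ℝ) (T := A.mulVecLin) (k := k) (s := s)
    (fun x y => by
      rw [hinner, hinner, mulVecLin_apply, mulVecLin_apply, mulVec_dotProduct_mulVec_mulVec, hBA])
    (by simpa using hι)
  have hb : ∀ x y, x ⬝ᵥ (LinearMap.toMatrix₂' ℝ b) *ᵥ y = b x y := fun x y => by
    rw [← toLinearMap₂'_apply', toLinearMap₂'_toMatrix']
  refine ⟨LinearMap.toMatrix₂' ℝ b, U, W, ?_, ?_, hU, hW, ?_, ?_⟩
  · ext i j
    simp [LinearMap.toMatrix₂'_apply, hsymm]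
  · rw [LinearMap.mul_toMatrix₂'_mul, transpose_transpose]
    congr 1
    exact LinearMap.ext₂ hinv
  · intro x hx h0
    rw [hb]; exact hbU x hx h0
  · intro x hx h0
    rw [hb]; exact hbW x hx h0

open Matrix Topology in
/-- Positive definiteness on a subspace is an open condition. -/
lemma Matrix.eventually_pos_on_submodule {ι : Type*} [Fintype ι] {M : Matrix ι ι ℝ}
    {V : Submodule ℝ (ι → ℝ)} (hV : ∀ x ∈ V, x ≠ 0 → 0 < x ⬝ᵥ M *ᵥ x) :
    ∀ᶠ N in 𝓝 M, ∀ x ∈ V, x ≠ 0 → 0 < x ⬝ᵥ N *ᵥ x := by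
  have hK : IsCompact (Metric.sphere (0 : ι → ℝ) 1 ∩ V) :=
    (isCompact_sphere _ _).inter_right (Submodule.closed_of_finiteDimensional V)
  have hcont : Continuous fun z : Matrix ι ι ℝ × (ι → ℝ) => z.2 ⬝ᵥ z.1 *ᵥ z.2 := by fun_prop
  have h := hK.eventually_forall_of_forall_eventually (x₀ := M)
    (P := fun N x => 0 < x ⬝ᵥ N *ᵥ x) fun x hx =>
      hcont.continuousAt.eventually_const_lt (hV x hx.2 (ne_zero_of_mem_unit_sphere ⟨x, hx.1⟩))
  filter_upwards [h] with N hN x hx h0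
  have hx' := hN (‖x‖⁻¹ • x) ⟨by simp [norm_smul, h0], V.smul_mem _ hx⟩
  rw [mulVec_smul, dotProduct_smul, smul_dotProduct, smul_eq_mul, smul_eq_mul, ← mul_assoc] at hx'
  exact pos_of_mul_pos_right hx' (by positivity)

open Matrix Topology in
lemma Matrix.eventually_neg_on_submodule {ι : Type*} [Fintype ι] {M : Matrix ι ι ℝ}
    {V : Submodule ℝ (ι → ℝ)} (hV : ∀ x ∈ V, x ≠ 0 → x ⬝ᵥ M *ᵥ x < 0) :
    ∀ᶠ N in 𝓝 M, ∀ x ∈ V, x ≠ 0 → x ⬝ᵥ N *ᵥ x < 0 := by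
  have h := eventually_pos_on_submodule (M := -M) (V := V) fun x hx h0 => by
    simpa [neg_mulVec] using hV x hx h0
  filter_upwards [continuous_neg.continuousAt.eventually h] with N hN x hx h0
  simpa [neg_mulVec] using hN x hx h0

open Filter Topology in
lemma tendsto_intFloor_natCast_mul_div (a : ℝ) :
    Tendsto (fun t : ℕ => (t : ℝ)⁻¹ * (⌊t * a⌋ : ℝ)) atTop (𝓝 a) := by
  have h : Tendsto (fun t : ℕ => a - (t : ℝ)⁻¹) atTop (𝓝 a) := by
    simpa using (tendsto_const_nhds (x := a)).sub (tendsto_inv_atTop_nhds_zero_nat (𝕜 := ℝ))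
  refine tendsto_of_tendsto_of_tendsto_of_le_of_le' h tendsto_const_nhds ?_ ?_ <;>
    filter_upwards [eventually_gt_atTop 0] with t ht <;>
    have ht' : (0 : ℝ) < t := Nat.cast_pos.mpr ht
  · have := Int.sub_one_lt_floor (t * a)
    rw [← div_eq_inv_mul, le_div_iff₀ ht', sub_mul, inv_mul_cancel₀ ht'.ne']
    linarith
  · have := Int.floor_le (t * a)
    rw [← div_eq_inv_mul, div_le_iff₀ ht']
    linarith

open Module Matrix Filter Topology in
/-- An integer matrix of finite order preserves even nondegenerate forms of every signature with an
even number of negative squares. -/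
lemma Matrix.exists_even_invariant_form_of_pow_eq_one {ι : Type*} [Fintype ι] [DecidableEq ι]
    {Θ : Matrix ι ι ℤ} {m : ℕ} (hm : 0 < m) (hΘ : Θ ^ m = 1) {k s : ℕ}
    (hι : Fintype.card ι = 2 * k + s) :
    ∃ G : Matrix ι ι ℤ, Gᵀ = G ∧ (∀ i, Even (G i i)) ∧ G.det ≠ 0 ∧
      (∃ hH : (G.map (Int.cast : ℤ → ℝ)).IsHermitian,
        (Finset.univ.filter fun i => hH.eigenvalues i < 0).card = 2 * k ∧
        (Finset.univ.filter fun i => 0 < hH.eigenvalues i).card = s) ∧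
      Θᵀ * G * Θ = G := by
  set A : Matrix ι ι ℝ := (Int.castRingHom ℝ).mapMatrix Θ with hAdef
  have hA : A ^ m = 1 := by rw [hAdef, ← map_pow, hΘ, map_one]
  obtain ⟨M, U, W, hsymm, hinv, hU, hW, hMU, hMW⟩ :=
    Matrix.exists_invariant_form_of_pow_eq_one hm hA (k := k) (s := s) hι
  let avg : Matrix ι ι ℝ → Matrix ι ι ℝ := fun N =>
    ∑ j ∈ Finset.range m, (A ^ j)ᵀ * N * A ^ j
  have havg : avg M = (m : ℝ) • M := by
    have hj : ∀ j, (A ^ j)ᵀ * M * A ^ j = M := fun j => by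
      induction j with
      | zero => simp
      | succ j ih =>
        calc (A ^ (j + 1))ᵀ * M * A ^ (j + 1) = Aᵀ * ((A ^ j)ᵀ * M * A ^ j) * A := by
              rw [pow_succ, transpose_mul]; simp only [Matrix.mul_assoc]
          _ = M := by rw [ih, hinv]
    simp only [avg, hj, Finset.sum_const, Finset.card_range, Nat.cast_smul_eq_nsmul]
  let F : ℕ → Matrix ι ι ℤ := fun t => Matrix.of fun i j => ⌊t * M i j⌋
  have hF : Tendsto (fun t : ℕ => (t : ℝ)⁻¹ • (F t).map (Int.cast : ℤ → ℝ)) atTop (𝓝 M) :=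
    tendsto_pi_nhds.mpr fun i => tendsto_pi_nhds.mpr fun j =>
      tendsto_intFloor_natCast_mul_div (M i j)
  have hcont : Continuous avg := by fun_prop
  have hlim := (hcont.tendsto M).comp hF
  rw [havg] at hlim
  have hm' : (0 : ℝ) < m := Nat.cast_pos.mpr hm
  have hneg := hlim.eventually (eventually_neg_on_submodule (V := U) fun x hx h0 => by
    rw [smul_mulVec, dotProduct_smul]
    exact mul_neg_of_pos_of_neg hm' (hMU x hx h0))
  have hpos := hlim.eventually (eventually_pos_on_submodule (V := W) fun x hx h0 => by
    rw [smul_mulVec, dotProduct_smul]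
    exact mul_pos hm' (hMW x hx h0))
  obtain ⟨t, hnegt, hpost, ht⟩ := (hneg.and (hpos.and (eventually_gt_atTop 0))).exists
  have ht' : (0 : ℝ) < t := Nat.cast_pos.mpr ht
  let S : Matrix ι ι ℤ := ∑ j ∈ Finset.range m, (Θ ^ j)ᵀ * F t * Θ ^ j
  have hSsymm : Sᵀ = S := transpose_sum_pow_mul Θ m <| by
    ext i j
    simp [F, hsymm.apply i j]
  let G : Matrix ι ι ℤ := (2 : ℤ) • S
  have hGsymm : Gᵀ = G := by rw [transpose_smul, hSsymm]
  have hquad : ∀ x, x ⬝ᵥ G.map (Int.cast : ℤ → ℝ) *ᵥ x =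
      2 * t * (x ⬝ᵥ avg ((t : ℝ)⁻¹ • (F t).map (Int.cast : ℤ → ℝ)) *ᵥ x) := fun x => by
    have hS : G.map (Int.cast : ℤ → ℝ) =
        (2 * t : ℝ) • avg ((t : ℝ)⁻¹ • (F t).map (Int.cast : ℤ → ℝ)) := by
      have h1 : (Int.castRingHom ℝ).mapMatrix S = avg ((F t).map (Int.cast : ℤ → ℝ)) := by
        simp only [S, avg, map_sum, map_mul, hAdef, ← map_pow]
        rfl
      have h2 : avg ((t : ℝ)⁻¹ • (F t).map (Int.cast : ℤ → ℝ)) =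
          (t : ℝ)⁻¹ • avg ((F t).map (Int.cast : ℤ → ℝ)) := by
        simp [avg, Finset.smul_sum]
      rw [h2, smul_smul, mul_assoc, mul_inv_cancel₀ ht'.ne', mul_one, ← h1]
      ext i j
      change ((2 * S i j : ℤ) : ℝ) = 2 * (S i j : ℝ)
      norm_num
    rw [hS, smul_mulVec, dotProduct_smul, smul_eq_mul]
  have hH : (G.map (Int.cast : ℤ → ℝ)).IsHermitian := by
    rw [IsHermitian, conjTranspose_eq_transpose_of_trivial, ← transpose_map, hGsymm]
  obtain ⟨hdet, hr', hs'⟩ := hH.signature_of_definite_subspaces (U := U) (W := W)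
    (by rw [hU, hW, hι])
    (fun x hx h0 => by
      rw [hquad]
      exact mul_neg_of_pos_of_neg (by positivity) (hnegt x hx h0))
    (fun x hx h0 => by
      rw [hquad]
      exact mul_pos (by positivity) (hpost x hx h0))
  refine ⟨G, hGsymm, fun i => ⟨S i i, by simp [G, two_mul]⟩, fun h0 => hdet ?_,
    ⟨hH, by rw [hr', hU], by rw [hs', hW]⟩, ?_⟩
  · have := (Int.castRingHom ℝ).map_det G
    rw [h0, map_zero] at this
    exact this.symm
  · rw [Matrix.mul_smul, Matrix.smul_mul, transpose_mul_sum_pow_mul hΘ]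
/-- Let `r, s` be even non-negative integers, `n = r + s`, and let
`θ ∈ GL(n, ℤ)` have finite multiplicative order. Then there is an `n × n` symmetric
integer matrix `G` with even diagonal, `det G ≠ 0`, and signature `(r, s)` such that
`θᵀ G θ = G`. -/
theorem finite_order_GL_int_is_isometry_of_even_lattice
    (r s n : ℕ) (hr : Even r) (hs : Even s) (hn : n = r + s)
    (θ : Matrix.GeneralLinearGroup (Fin n) ℤ) (hfin : IsOfFinOrder θ) :
    ∃ G : Matrix (Fin n) (Fin n) ℤ,
      G.transpose = G ∧ (∀ i, Even (G i i)) ∧ G.det ≠ 0 ∧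
      (∃ hH : (G.map (Int.cast : ℤ → ℝ)).IsHermitian,
        (Finset.univ.filter fun i => hH.eigenvalues i < 0).card = r ∧
        (Finset.univ.filter fun i => 0 < hH.eigenvalues i).card = s) ∧
      (θ : Matrix (Fin n) (Fin n) ℤ).transpose * G * (θ : Matrix (Fin n) (Fin n) ℤ) = G := by
  obtain ⟨k, rfl⟩ := even_iff_exists_two_mul.mp hr
  obtain ⟨m, hm, hθ⟩ := isOfFinOrder_iff_pow_eq_one.mp hfin
  exact Matrix.exists_even_invariant_form_of_pow_eq_one hm
    (by simpa using congrArg Units.val hθ) (by simpa using hn)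
end

section
/- Gluing Lemma: Let (Λ₁, B₁) and (Λ₂, B₂) be even lattices, i.e. finite-rank free ℤ-modules Λᵢ with symmetric ℤ-bilinear forms Bᵢ such that Bᵢ(v,v) ∈ 2ℤ for all v and Bᵢ is nondegenerate after ℚ-bilinear extension to Vᵢ = ℚ ⊗ Λᵢ. Let Λᵢ* = {w ∈ Vᵢ : Bᵢ(w, v) ∈ ℤ for all v ∈ Λᵢ} be the dual lattice, D(Λᵢ) = Λᵢ*/Λᵢ the discriminant group, and q̄ᵢ : D(Λᵢ) → ℚ/2ℤ the induced quadratic form q̄ᵢ([w]) = Bᵢ(w,w) mod 2ℤ. Suppose ψ : D(Λ₁) → D(Λ₂) is a group isomorphism satisfying q̄₂(ψ(x)) = q̄₁(x) for all x ∈ D(Λ₁). Then the ℤ-submodule Γ := {(v, w) ∈ Λ₁* × Λ₂* : ψ([v]) = [w]} of V₁ × V₂, equipped with the bilinear form B((v,w),(v',w')) = −B₁(v,v') + B₂(w,w'), is an even unimodular lattice: B takes integer values on Γ × Γ, B((v,w),(v,w)) ∈ 2ℤ for all (v,w) ∈ Γ, and Γ equals its own dual lattice {u ∈ V₁ × V₂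 : B(u, γ) ∈ ℤ for all γ ∈ Γ}. -/
noncomputable section

/-- The standard lattice of integer vectors inside `Fin n → ℚ` (a free `ℤ`-module of
rank `n`; any finite-rank free `ℤ`-module inside its rationalization is of this form in
a basis). -/
def intLattice (n : ℕ) : Submodule ℤ (Fin n → ℚ) where
  carrier := {x | ∀ i, ∃ k : ℤ, x i = (k : ℚ)}
  add_mem' := by
    intro x y hx hy i
    obtain ⟨a, ha⟩ := hx i
    obtain ⟨b, hb⟩ := hy i
    exact ⟨a + b, by simp [ha, hb]⟩
  zero_mem' := fun i => ⟨0, by simp⟩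
  smul_mem' := by
    intro c x hx i
    obtain ⟨a, ha⟩ := hx i
    exact ⟨c * a, by simp [Pi.smul_apply, ha, zsmul_eq_mul]⟩

/-- The dual lattice `Λ* = {w ∈ ℚⁿ : B(w, v) ∈ ℤ for all v ∈ Λ}` of the standard lattice
`Λ = ℤⁿ` with respect to a `ℚ`-bilinear form `B` on `ℚⁿ`. -/
def dualLattice (n : ℕ) (B : (Fin n → ℚ) →ₗ[ℚ] (Fin n → ℚ) →ₗ[ℚ] ℚ) :
    Submodule ℤ (Fin n → ℚ) where
  carrier := {w | ∀ v ∈ intLattice n, ∃ k : ℤ, B w v = (k : ℚ)}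
  add_mem' := by
    intro x y hx hy v hv
    obtain ⟨a, ha⟩ := hx v hv
    obtain ⟨b, hb⟩ := hy v hv
    exact ⟨a + b, by simp [ha, hb]⟩
  zero_mem' := fun v hv => ⟨0, by simp⟩
  smul_mem' := by
    intro c x hx v hv
    obtain ⟨a, ha⟩ := hx v hv
    refine ⟨c * a, ?_⟩
    have : B (c • x) v = c • B x v := by
      rw [map_zsmul, LinearMap.smul_apply]
    rw [this, ha, zsmul_eq_mul]
    push_cast
    ring

/-- The copy of the lattice `Λ = ℤⁿ` inside its dual lattice `Λ*`. -/
def latticeInDual (n : ℕ) (B : (Fin n → ℚ) →ₗ[ℚ] (Fin n → ℚ) →ₗ[ℚ] ℚ) :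
    Submodule ℤ (dualLattice n B) :=
  (intLattice n).comap (dualLattice n B).subtype

/-- The discriminant group `D(Λ) = Λ*/Λ` of the standard lattice with respect to the
bilinear form `B`. -/
abbrev DiscriminantGroup (n : ℕ) (B : (Fin n → ℚ) →ₗ[ℚ] (Fin n → ℚ) →ₗ[ℚ] ℚ) :=
  (dualLattice n B) ⧸ (latticeInDual n B)

/-- The coordinate functionals are represented by a nondegenerate form. -/
theorem exists_dual_coordinate {n : ℕ} (B : (Fin n → ℚ) →ₗ[ℚ] (Fin n → ℚ) →ₗ[ℚ] ℚ)
    (hnd : ∀ x, (∀ y, B x y = 0) → x = 0) (i : Fin n) :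
    ∃ y, ∀ v, B y v = v i := by
  have hinj : Function.Injective B := by
    rw [injective_iff_map_eq_zero]
    intro x hx
    exact hnd x fun y => by rw [hx, LinearMap.zero_apply]
  have hsurj : Function.Surjective B :=
    (LinearMap.injective_iff_surjective_of_finrank_eq_finrank
      (Subspace.dual_finrank_eq (K := ℚ) (V := Fin n → ℚ)).symm).1 hinj
  obtain ⟨y, hy⟩ := hsurj (LinearMap.proj i)
  exact ⟨y, fun v => by rw [hy, LinearMap.proj_apply]⟩

/-- A vector pairing integrally with the dual lattice lies in the lattice. -/
theorem mem_intLattice_of_forall_dualLattice {n : ℕ}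
    (B : (Fin n → ℚ) →ₗ[ℚ] (Fin n → ℚ) →ₗ[ℚ] ℚ)
    (hsym : ∀ x y, B x y = B y x) (hnd : ∀ x, (∀ y, B x y = 0) → x = 0) {x : Fin n → ℚ}
    (hx : ∀ y ∈ dualLattice n B, ∃ k : ℤ, B x y = (k : ℚ)) : x ∈ intLattice n := by
  intro i
  obtain ⟨y, hy⟩ := exists_dual_coordinate B hnd i
  obtain ⟨k, hk⟩ := hx y fun v hv => by rw [hy]; exact hv i
  exact ⟨k, by rw [← hk, hsym, hy]⟩

/-- **Gluing Lemma.** Let `(ℤ^{n₁}, B₁)` and `(ℤ^{n₂}, B₂)` be even lattices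
(symmetric nondegenerate `ℚ`-bilinear forms, `ℤ`-valued and even on the lattice), and let
`ψ : D(Λ₁) ≃ D(Λ₂)` be a group isomorphism of discriminant groups preserving the induced
`ℚ/2ℤ`-valued quadratic forms. Then the glued lattice
`Γ = {(v, w) ∈ Λ₁* × Λ₂* : ψ([v]) = [w]}` with bilinear form
`B((v,w),(v',w')) = -B₁(v,v') + B₂(w,w')` is even unimodular: `B` is integer-valued on
`Γ`, even on the diagonal, and `Γ` equals its own dual lattice. -/
theorem gluing_lemma (n₁ n₂ : ℕ)
    (B₁ : (Fin n₁ → ℚ) →ₗ[ℚ] (Fin n₁ → ℚ) →ₗ[ℚ] ℚ)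
    (B₂ : (Fin n₂ → ℚ) →ₗ[ℚ] (Fin n₂ → ℚ) →ₗ[ℚ] ℚ)
    (hsym₁ : ∀ x y, B₁ x y = B₁ y x) (hsym₂ : ∀ x y, B₂ x y = B₂ y x)
    (hnd₁ : ∀ x, (∀ y, B₁ x y = 0) → x = 0)
    (hnd₂ : ∀ x, (∀ y, B₂ x y = 0) → x = 0)
    (hint₁ : ∀ v ∈ intLattice n₁, ∀ w ∈ intLattice n₁, ∃ k : ℤ, B₁ v w = (k : ℚ))
    (hint₂ : ∀ v ∈ intLattice n₂, ∀ w ∈ intLattice n₂, ∃ k : ℤ, B₂ v w = (k : ℚ))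
    (heven₁ : ∀ v ∈ intLattice n₁, ∃ k : ℤ, B₁ v v = 2 * (k : ℚ))
    (heven₂ : ∀ v ∈ intLattice n₂, ∃ k : ℤ, B₂ v v = 2 * (k : ℚ))
    (ψ : DiscriminantGroup n₁ B₁ ≃+ DiscriminantGroup n₂ B₂)
    (hψq : ∀ (v : dualLattice n₁ B₁) (w : dualLattice n₂ B₂),
      ψ (Submodule.Quotient.mk v) = Submodule.Quotient.mk w →
      ∃ k : ℤ, B₂ w w - B₁ v v = 2 * (k : ℚ))
    (Γ : Set ((Fin n₁ → ℚ) × (Fin n₂ → ℚ)))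
    (hΓ : Γ = {p | ∃ (hv : p.1 ∈ dualLattice n₁ B₁) (hw : p.2 ∈ dualLattice n₂ B₂),
      ψ (Submodule.Quotient.mk ⟨p.1, hv⟩) = Submodule.Quotient.mk ⟨p.2, hw⟩}) :
    (∀ p ∈ Γ, ∀ q ∈ Γ, ∃ k : ℤ, -B₁ p.1 q.1 + B₂ p.2 q.2 = (k : ℚ)) ∧
    (∀ p ∈ Γ, ∃ k : ℤ, -B₁ p.1 p.1 + B₂ p.2 p.2 = 2 * (k : ℚ)) ∧
    {u : (Fin n₁ → ℚ) × (Fin n₂ → ℚ) |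
      ∀ γ ∈ Γ, ∃ k : ℤ, -B₁ u.1 γ.1 + B₂ u.2 γ.2 = (k : ℚ)} = Γ := by
  have heven : ∀ p ∈ Γ, ∃ k : ℤ, -B₁ p.1 p.1 + B₂ p.2 p.2 = 2 * (k : ℚ) := by
    intro p hp
    rw [hΓ] at hp
    obtain ⟨hv, hw, h⟩ := hp
    obtain ⟨k, hk⟩ := hψq _ _ h
    exact ⟨k, by rw [← hk]; ring⟩
  have hadd : ∀ p ∈ Γ, ∀ q ∈ Γ, p + q ∈ Γ := by
    intro p hp q hq
    rw [hΓ] at hp hq ⊢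
    obtain ⟨hv, hw, h⟩ := hp
    obtain ⟨hv', hw', h'⟩ := hq
    refine ⟨add_mem hv hv', add_mem hw hw', ?_⟩
    have := congrArg₂ (· + ·) h h'
    simp only [← map_add, ← Submodule.Quotient.mk_add] at this
    exact this
  have hint : ∀ p ∈ Γ, ∀ q ∈ Γ, ∃ k : ℤ, -B₁ p.1 q.1 + B₂ p.2 q.2 = (k : ℚ) := by
    intro p hp q hq
    obtain ⟨a, ha⟩ := heven p hp
    obtain ⟨b, hb⟩ := heven q hq
    obtain ⟨c, hc⟩ := heven _ (hadd p hp q hq)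
    refine ⟨c - a - b, ?_⟩
    simp only [Prod.fst_add, Prod.snd_add, map_add, LinearMap.add_apply,
      hsym₁ q.1 p.1, hsym₂ q.2 p.2] at hc
    push_cast
    linarith
  refine ⟨hint, heven, Set.Subset.antisymm ?_ fun u hu γ hγ => hint u hu γ hγ⟩
  rintro ⟨a, b⟩ hu
  have hmk₁ : ∀ v (hv : v ∈ intLattice n₁) (hv' : v ∈ dualLattice n₁ B₁),
      (Submodule.Quotient.mk ⟨v, hv'⟩ : DiscriminantGroup n₁ B₁) = 0 := fun v hv hv' =>
    (Submodule.Quotient.mk_eq_zero _).2 hv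
  have hmk₂ : ∀ w (hw : w ∈ intLattice n₂) (hw' : w ∈ dualLattice n₂ B₂),
      (Submodule.Quotient.mk ⟨w, hw'⟩ : DiscriminantGroup n₂ B₂) = 0 := fun w hw hw' =>
    (Submodule.Quotient.mk_eq_zero _).2 hw
  have ha : a ∈ dualLattice n₁ B₁ := by
    intro v hv
    have hmem : ((v, 0) : (Fin n₁ → ℚ) × (Fin n₂ → ℚ)) ∈ Γ := by
      rw [hΓ]
      refine ⟨hint₁ v hv, zero_mem _, ?_⟩
      exact (congrArg ψ (hmk₁ v hv (hint₁ v hv))).trans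
        ((map_zero ψ).trans (hmk₂ 0 (zero_mem _) (zero_mem _)).symm)
    obtain ⟨k, hk⟩ := hu _ hmem
    refine ⟨-k, ?_⟩
    simp only [map_zero, add_zero] at hk
    push_cast
    linarith
  have hb : b ∈ dualLattice n₂ B₂ := by
    intro w hw
    have hmem : ((0, w) : (Fin n₁ → ℚ) × (Fin n₂ → ℚ)) ∈ Γ := by
      rw [hΓ]
      refine ⟨zero_mem _, hint₂ w hw, ?_⟩
      exact (congrArg ψ (hmk₁ 0 (zero_mem _) (zero_mem _))).trans
        ((map_zero ψ).trans (hmk₂ w hw (hint₂ w hw)).symm)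
    obtain ⟨k, hk⟩ := hu _ hmem
    exact ⟨k, by simpa using hk⟩
  obtain ⟨⟨c, hc⟩, hac⟩ := Submodule.Quotient.mk_surjective _ (ψ (Submodule.Quotient.mk ⟨a, ha⟩))
  have hacΓ : (a, c) ∈ Γ := by
    rw [hΓ]
    exact ⟨ha, hc, hac.symm⟩
  have hcb : c - b ∈ intLattice n₂ := by
    refine mem_intLattice_of_forall_dualLattice B₂ hsym₂ hnd₂ fun y hy => ?_
    obtain ⟨⟨x, hx⟩, hxy⟩ := Submodule.Quotient.mk_surjective _
      (ψ.symm (Submodule.Quotient.mk ⟨y, hy⟩))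
    have hxyΓ : (x, y) ∈ Γ := by
      rw [hΓ]
      exact ⟨hx, hy, by rw [hxy, AddEquiv.apply_symm_apply]⟩
    obtain ⟨k, hk⟩ := hint _ hacΓ _ hxyΓ
    obtain ⟨l, hl⟩ := hu _ hxyΓ
    refine ⟨k - l, ?_⟩
    simp only [map_sub, LinearMap.sub_apply] at hk hl ⊢
    push_cast
    linarith
  rw [hΓ]
  exact ⟨ha, hb, hac.symm.trans ((Submodule.Quotient.eq _).2 hcb)⟩

end
end

section
/- Let G be the 4×4 integer matrix with entries G_{ij} = a_{|i−j|} where (a_0, a_1, a_2, a_3) = (0, −1, 0, 0), i.e. G = [[0,−1,0,0],[−1,0,−1,0],[0,−1,0,−1],[0,0,−1,0]], and let C be the companion matrix of the 12th cyclotomic polynomial Φ₁₂(X) = X⁴ − X² + 1, i.e. C = [[0,0,0,−1],[1,0,0,0],[0,1,0,1],[0,0,1,0]]. Then: (i) det G = 1; (ii) every diagonal entry of G is even; (iii) Cᵀ G C = G; (iv) the characteristic polynomial of C is Φ₁₂, so C has multiplicative order 12; (v) the real symmetric matrix G has exactly 2 positive and 2 negative eigenvalues. (Hence G is the Gram matrix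 of an even unimodular lattice of signature (2;2) with a ℤ₁₂ quasicrystalline symmetry.) -/
open Polynomial in
/-- The twelfth cyclotomic polynomial is `X⁴ - X² + 1`. -/
theorem cyclotomic_twelve_int : cyclotomic 12 ℤ = X ^ 4 - X ^ 2 + 1 := by
  have h := cyclotomic_expand_eq_cyclotomic Nat.prime_two (n := 6) (by norm_num) ℤ
  rw [cyclotomic_six] at h
  norm_num at h
  rw [← h]
  ring

open Polynomial in
/-- The number of eigenvalues of a Hermitian matrix with a given property can be read off
from a factorization of its characteristic polynomial. -/
theorem Matrix.IsHermitian.card_filter_eigenvalues_of_charpoly_eq {n : Type*} [Fintype n]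
    [DecidableEq n] {A : Matrix n n ℝ} (hA : A.IsHermitian) (s : Multiset ℝ)
    (hs : A.charpoly = (s.map fun r => X - C r).prod) (p : ℝ → Prop) [DecidablePred p] :
    (Finset.univ.filter fun i => p (hA.eigenvalues i)).card = s.countP p := by
  have h := hA.roots_charpoly_eq_eigenvalues
  rw [hs, roots_multiset_prod_X_sub_C] at h
  rw [h, Multiset.countP_map]
  rfl


/-- The Gram matrix `G` with entries `G_{ij} = a_{|i-j|}`,
`(a₀, a₁, a₂, a₃) = (0, -1, 0, 0)`, is even unimodular of signature `(2; 2)`, and the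
companion matrix `C` of the 12th cyclotomic polynomial `Φ₁₂(X) = X⁴ - X² + 1` is an
isometry of `G` of multiplicative order 12. -/
theorem Z12_quasicrystal_gram_matrix :
    let G : Matrix (Fin 4) (Fin 4) ℤ :=
      !![0, -1, 0, 0; -1, 0, -1, 0; 0, -1, 0, -1; 0, 0, -1, 0]
    let C : Matrix (Fin 4) (Fin 4) ℤ :=
      !![0, 0, 0, -1; 1, 0, 0, 0; 0, 1, 0, 1; 0, 0, 1, 0]
    G.det = 1 ∧
    (∀ i, Even (G i i)) ∧
    C.transpose * G * C = G ∧
    (C.charpoly = Polynomial.cyclotomic 12 ℤ ∧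
      C ^ 12 = 1 ∧ (∀ k, 0 < k → k < 12 → C ^ k ≠ 1)) ∧
    (∃ hH : (G.map (Int.cast : ℤ → ℝ)).IsHermitian,
      (Finset.univ.filter fun i => 0 < hH.eigenvalues i).card = 2 ∧
      (Finset.univ.filter fun i => hH.eigenvalues i < 0).card = 2) := by
  intro G C
  refine ⟨by decide +kernel, by decide, by decide +kernel, ⟨?_, by decide +kernel, ?_⟩, ?_⟩
  · rw [cyclotomic_twelve_int, Matrix.charpoly]
    simp [C, Matrix.charmatrix, Matrix.det_succ_row_zero, Fin.sum_univ_succ, Fin.succAbove,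
      Matrix.diagonal]
    ring
  · intro k hk hk'
    interval_cases k <;> decide +kernel
  · have hH : (G.map (Int.cast : ℤ → ℝ)).IsHermitian := by
      ext i j
      fin_cases i <;> fin_cases j <;> simp [G]
    have hs : (G.map (Int.cast : ℤ → ℝ)).charpoly =
        (({Real.goldenRatio, -Real.goldenConj, Real.goldenConj, -Real.goldenRatio} :
          Multiset ℝ).map fun r => Polynomial.X - Polynomial.C r).prod := by
      have hsum := congrArg Polynomial.C Real.goldenRatio_add_goldenConj
      have hmul := congrArg Polynomial.C Real.goldenRatio_mul_goldenConj
      simp only [map_add, map_mul, map_neg, map_one] at hsum hmul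
      rw [Matrix.charpoly]
      simp [G, Matrix.charmatrix, Matrix.det_succ_row_zero, Fin.sum_univ_succ, Fin.succAbove,
        Matrix.diagonal]
      grind
    have hφ := Real.goldenRatio_pos
    have hψ := Real.goldenConj_neg
    refine ⟨hH, ?_, ?_⟩
    · rw [hH.card_filter_eigenvalues_of_charpoly_eq _ hs (fun x => 0 < x)]
      simp [← Multiset.cons_zero, hφ, hψ, hφ.not_gt, hψ.not_gt]
    · rw [hH.card_filter_eigenvalues_of_charpoly_eq _ hs (fun x => x < 0)]
      simp [← Multiset.cons_zero, hφ, hψ, hφ.not_gt, hψ.not_gt]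
end

section
/- Let G be the 12×12 integer matrix with entries G_{ij} = a_{|i−j|} where (a_0, …, a_{11}) = (−2, 0, 1, 0, 0, 1, 1, −1, −1, 0, 0, 0), and let C be the companion matrix of the 42nd cyclotomic polynomial Φ₄₂(X) = X¹² + X¹¹ − X⁹ − X⁸ + X⁶ − X⁴ − X³ + X + 1. Then: (i) |det G| = 1; (ii) every diagonal entry of G is even; (iii) Cᵀ G C = G; (iv) the characteristic polynomial of C is Φ₄₂, so C has multiplicative order 42; (v) the real symmetric matrix G has exactly 10 negative and 2 positive eigenvalues. (Hence G is the Gram matrix of an even unimodular irreducible quasicrystal of signature (10;2) with ℤ₄₂ symmetry.) -/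
open Polynomial in
theorem cyclotomic_forty_two (R : Type*) [CommRing R] : cyclotomic 42 R =
    X ^ 12 + X ^ 11 - X ^ 9 - X ^ 8 + X ^ 6 - X ^ 4 - X ^ 3 + X + 1 := by
  have hℤ : cyclotomic 42 ℤ =
      X ^ 12 + X ^ 11 - X ^ 9 - X ^ 8 + X ^ 6 - X ^ 4 - X ^ 3 + X + 1 := by
    have h := cyclotomic_expand_eq_cyclotomic_mul (p := 7) (n := 6) (by norm_num) (by norm_num) ℤ
    refine mul_right_cancel₀ (cyclotomic_ne_zero 6 ℤ) (h.symm.trans ?_)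
    simp only [cyclotomic_six, map_add, map_sub, map_pow, expand_X, map_one]
    ring
  rw [← map_cyclotomic_int, hℤ]
  simp

namespace Matrix

/-- If `Qᵀ * diagonal l * Q = diagonal d` and all `d j` have the sign of `ε`, then at least as many
of the `l i` have that sign. -/
theorem card_le_card_of_transpose_mul_diagonal_mul {m k : Type*} [Fintype m] [DecidableEq m]
    [Fintype k] [DecidableEq k] {l : m → ℝ} {d : k → ℝ} {Q : Matrix m k ℝ} (ε : ℝ)
    (hQ : Qᵀ * diagonal l * Q = diagonal d) (hd : ∀ j, 0 < ε * d j) :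
    Fintype.card k ≤ (Finset.univ.filter fun i => 0 < ε * l i).card := by
  let f : (k → ℝ) →ₗ[ℝ] ({i // 0 < ε * l i} → ℝ) :=
    LinearMap.funLeft ℝ ℝ Subtype.val ∘ₗ Q.mulVecLin
  have hf : Function.Injective f := by
    rw [← LinearMap.ker_eq_bot, LinearMap.ker_eq_bot']
    intro y hy
    have hy' : ∀ i, 0 < ε * l i → (Q *ᵥ y) i = 0 := fun i hi => congrFun hy ⟨i, hi⟩
    have key : ∑ j, ε * d j * y j ^ 2 = ∑ i, ε * l i * (Q *ᵥ y) i ^ 2 := by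
      have h : y ⬝ᵥ (diagonal d *ᵥ y) = (Q *ᵥ y) ⬝ᵥ (diagonal l *ᵥ (Q *ᵥ y)) := by
        rw [← hQ, ← mulVec_mulVec, ← mulVec_mulVec, dotProduct_mulVec, vecMul_transpose]
      simp only [dotProduct, mulVec_diagonal] at h
      calc ∑ j, ε * d j * y j ^ 2 = ε * ∑ j, y j * (d j * y j) := by
            rw [Finset.mul_sum]; exact Finset.sum_congr rfl fun j _ => by ring
        _ = ∑ i, ε * l i * (Q *ᵥ y) i ^ 2 := by
            rw [h, Finset.mul_sum]; exact Finset.sum_congr rfl fun i _ => by ring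
    have hnonpos : ∑ j, ε * d j * y j ^ 2 ≤ 0 := by
      rw [key]
      refine Finset.sum_nonpos fun i _ => ?_
      rcases lt_or_ge 0 (ε * l i) with hi | hi
      · simp [hy' i hi]
      · exact mul_nonpos_of_nonpos_of_nonneg hi (sq_nonneg _)
    have hnonneg : ∀ j ∈ Finset.univ, 0 ≤ ε * d j * y j ^ 2 :=
      fun j _ => mul_nonneg (hd j).le (sq_nonneg _)
    have hzero := (Finset.sum_eq_zero_iff_of_nonneg hnonneg).1
      (le_antisymm hnonpos (Finset.sum_nonneg hnonneg))
    ext j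
    simpa [(hd j).ne'] using hzero j (Finset.mem_univ j)
  simpa [Fintype.card_subtype] using LinearMap.finrank_le_finrank_of_injective hf

theorem IsHermitian.card_le_card_eigenvalues_of_transpose_mul_mul {m k : Type*} [Fintype m]
    [DecidableEq m] [Fintype k] [DecidableEq k] {A : Matrix m m ℝ} (hA : A.IsHermitian)
    {d : k → ℝ} {P : Matrix m k ℝ} (ε : ℝ) (hP : Pᵀ * A * P = diagonal d)
    (hd : ∀ j, 0 < ε * d j) :
    Fintype.card k ≤ (Finset.univ.filter fun i => 0 < ε * hA.eigenvalues i).card := by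
  refine card_le_card_of_transpose_mul_diagonal_mul
    (Q := (hA.eigenvectorUnitary : Matrix m m ℝ)ᵀ * P) ε ?_ hd
  have hspec := hA.spectral_theorem
  rw [Unitary.conjStarAlgAut_apply, star_eq_conjTranspose, conjTranspose_eq_transpose_of_trivial]
    at hspec
  rw [← hP, transpose_mul, transpose_transpose]
  conv_rhs => rw [hspec]
  simp only [Matrix.mul_assoc]
  rfl

end Matrix

namespace Z42

open Matrix

/-- The Toeplitz Gram matrix. -/
def gram : Matrix (Fin 12) (Fin 12) ℤ :=
  Matrix.of fun i j => (![-2, 0, 1, 0, 0, 1, 1, -1, -1, 0, 0, 0] : Fin 12 → ℤ)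
    ⟨(i.val - j.val) + (j.val - i.val), by have := i.isLt; have := j.isLt; omega⟩

/-- The companion matrix of `Φ₄₂`. -/
def companion : Matrix (Fin 12) (Fin 12) ℤ :=
  Matrix.of fun i j => if j.val = 11 then
    (![-1, -1, 0, 1, 1, 0, -1, 0, 1, 1, 0, -1] : Fin 12 → ℤ) i
    else if i.val = j.val + 1 then 1 else 0

/-- The inverse of `gram`. -/
def gramInv : Matrix (Fin 12) (Fin 12) ℤ :=
  !![-6, 0, 2, 5, 2, -3, -3, 3, 4, 1, -2, -6;
     0, 0, 2, 1, 1, -1, 0, 0, 1, -1, -1, -2;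
     2, 2, 0, 0, -1, 1, 1, 0, -2, -1, -1, 1;
     5, 1, 0, -4, -1, 2, 3, -2, -3, -2, 1, 4;
     2, 1, -1, -1, -2, 2, 1, 0, -2, 0, 0, 3;
     -3, -1, 1, 2, 2, -2, -1, 1, 3, 1, 0, -3;
     -3, 0, 1, 3, 1, -1, -2, 2, 2, 1, -1, -3;
     3, 0, 0, -2, 0, 1, 2, -2, -1, -1, 1, 2;
     4, 1, -2, -3, -2, 3, 2, -1, -4, 0, 1, 5;
     1, -1, -1, -2, 0, 1, 1, -1, 0, 0, 2, 2;
     -2, -1, -1, 1, 0, 0, -1, 1, 1, 2, 0, 0;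
     -6, -2, 1, 4, 3, -3, -3, 2, 5, 2, 0, -6]

/-- Columns forming an orthogonal basis of a negative definite subspace for `gram`. -/
def negBasis : Matrix (Fin 12) (Fin 10) ℤ :=
  !![1, 0, 1, 0, 1, 9, -15, -5, -1, 6;
     0, 1, 0, 1, 0, 4, 1, -5, -4, 2;
     0, 0, 2, 0, 2, 6, -5, 1, -1, -1;
     0, 0, 0, 2, 0, 8, 0, 0, -3, -4;
     0, 0, 0, 0, 3, 3, -8, 0, 3, -3;
     0, 0, 0, 0, 0, 12, -1, -3, 0, 3;
     0, 0, 0, 0, 0, 0, -11, -1, 1, 3;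
     0, 0, 0, 0, 0, 0, 13, -1, -2, -2;
     0, 0, 0, 0, 0, 0, 0, 8, 4, -5;
     0, 0, 0, 0, 0, 0, 0, 0, 0, -2;
     0, 0, 0, 0, 0, 0, 0, 0, 6, 0;
     0, 0, 0, 0, 0, 0, 0, 0, 0, 6]

/-- Columns forming an orthogonal basis of a positive definite subspace for `gram`. -/
def posBasis : Matrix (Fin 12) (Fin 2) ℤ :=
  !![19, -3;
     10, -5;
     15, -2;
     13, -2;
     11, 3;
     16, 0;
     7, 0;
     0, -1;
     0, 5;
     0, 2;
     0, 6;
     0, 0]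

theorem gram_mul_gramInv : gram * gramInv = 1 := by decide +kernel

theorem abs_det_gram : |gram.det| = 1 :=
  Int.isUnit_iff_abs_eq.1 <| IsUnit.of_mul_eq_one gramInv.det <| by
    rw [← det_mul, gram_mul_gramInv, det_one]

theorem even_gram_diag (i : Fin 12) : Even (gram i i) := by
  revert i
  decide +kernel

theorem companion_isometry : companionᵀ * gram * companion = gram := by decide +kernel

theorem gram_isSymm : gramᵀ = gram := by decide +kernel

theorem negBasis_orthogonal : negBasisᵀ * gram * negBasis =
    diagonal ![-2, -2, -6, -6, -12, -84, -208, -48, -6, -6] := by decide +kernel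

theorem posBasis_orthogonal : posBasisᵀ * gram * posBasis = diagonal ![182, 6] := by
  decide +kernel

theorem companion_pow_mulVec (j : ℕ) (hj : j < 12) :
    companion ^ j *ᵥ Pi.single 0 1 = Pi.single (⟨j, hj⟩ : Fin 12) 1 := by
  induction j with
  | zero => rw [pow_zero, one_mulVec]; rfl
  | succ j ih =>
    rw [pow_succ', ← mulVec_mulVec, ih (by omega), mulVec_single_one]
    have h : ∀ i : Fin 11, companion.col i.castSucc = Pi.single i.succ 1 := by decide +kernel
    exact h ⟨j, by omega⟩

open Polynomial in
theorem aeval_companion_cyclotomic : aeval companion (cyclotomic 42 ℤ) = 0 := by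
  have h0 : aeval companion (cyclotomic 42 ℤ) *ᵥ Pi.single 0 1 = 0 := by
    have h12 : companion ^ 12 *ᵥ Pi.single 0 1 = companion.col 11 := by
      rw [pow_succ', ← mulVec_mulVec, companion_pow_mulVec 11 (by norm_num), mulVec_single_one]
      rfl
    have h1 := companion_pow_mulVec 1 (by norm_num)
    rw [pow_one] at h1
    simp only [cyclotomic_forty_two, map_add, map_sub, map_pow, aeval_X, map_one, add_mulVec,
      sub_mulVec, h12, h1, one_mulVec]
    iterate 6 rw [companion_pow_mulVec _ (by norm_num)]
    decide +kernel
  refine ext_of_mulVec_single fun j => ?_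
  rw [← companion_pow_mulVec j j.isLt, mulVec_mulVec, zero_mulVec]
  have hcomm : aeval companion (cyclotomic 42 ℤ) * companion ^ (j : ℕ) =
      companion ^ (j : ℕ) * aeval companion (cyclotomic 42 ℤ) := by
    have hX : companion ^ (j : ℕ) = aeval companion (X ^ (j : ℕ) : ℤ[X]) := by simp
    rw [hX, ← map_mul, ← map_mul, mul_comm]
  rw [hcomm, ← mulVec_mulVec, h0, mulVec_zero]

/-- The companion matrix with rational entries. -/
abbrev companionRat : Matrix (Fin 12) (Fin 12) ℚ := (Int.castRingHom ℚ).mapMatrix companion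

open Polynomial in
theorem minpoly_companionRat : minpoly ℚ companionRat = cyclotomic 42 ℚ := by
  refine (minpoly.eq_of_irreducible_of_monic (cyclotomic.irreducible_rat (by norm_num)) ?_
    (cyclotomic.monic 42 ℚ)).symm
  have h := congrArg (Int.castRingHom ℚ).mapMatrix aeval_companion_cyclotomic
  simpa only [cyclotomic_forty_two, map_add, map_sub, map_pow, map_one, map_zero, aeval_X] using h

open Polynomial in
theorem charpoly_companion : companion.charpoly = cyclotomic 42 ℤ := by
  refine map_injective (Int.castRingHom ℚ) Int.cast_injective ?_
  rw [← charpoly_map, map_cyclotomic_int]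
  refine eq_of_monic_of_dvd_of_natDegree_le (cyclotomic.monic 42 ℚ) (charpoly_monic _) ?_ ?_
  · rw [← minpoly_companionRat]
    exact minpoly_dvd_charpoly _
  · rw [charpoly_natDegree_eq_dim, natDegree_cyclotomic]
    decide +kernel

open Polynomial in
theorem companion_pow_eq_one : companion ^ 42 = 1 := by
  obtain ⟨q, hq⟩ := cyclotomic.dvd_X_pow_sub_one 42 ℤ
  have h := congrArg (aeval companion) hq
  rw [map_mul, aeval_companion_cyclotomic, zero_mul] at h
  simpa [sub_eq_zero] using h

open Polynomial in
theorem companion_pow_ne_one (k : ℕ) (hk : 0 < k) (hk' : k < 42) : companion ^ k ≠ 1 := by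
  intro h
  have hrat : aeval companionRat (X ^ k - 1 : ℚ[X]) = 0 := by
    have := congrArg (Int.castRingHom ℚ).mapMatrix h
    rw [map_pow, map_one] at this
    rw [map_sub, map_pow, aeval_X, map_one, this, sub_self]
  have hdvd := minpoly.dvd ℚ companionRat hrat
  have hζ := Complex.isPrimitiveRoot_exp 42 (by norm_num)
  rw [minpoly_companionRat, cyclotomic_eq_minpoly_rat hζ (by norm_num), minpoly.dvd_iff] at hdvd
  exact hζ.pow_ne_one_of_pos_of_lt hk.ne' hk' (by simpa [sub_eq_zero] using hdvd)

/-- The Gram matrix with real entries. -/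
abbrev gramReal : Matrix (Fin 12) (Fin 12) ℝ := gram.map Int.cast

theorem gramReal_isHermitian : gramReal.IsHermitian := by
  rw [IsHermitian, conjTranspose_eq_transpose_of_trivial, ← transpose_map, gram_isSymm]

theorem card_le_card_eigenvalues {k : ℕ} (ε : ℤ) {d : Fin k → ℤ} {P : Matrix (Fin 12) (Fin k) ℤ}
    (hP : Pᵀ * gram * P = diagonal d) (hd : ∀ j, 0 < ε * d j) :
    k ≤ (Finset.univ.filter fun i => 0 < ε * gramReal_isHermitian.eigenvalues i).card := by
  have h := gramReal_isHermitian.card_le_card_eigenvalues_of_transpose_mul_mul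
    (P := P.map (Int.castRingHom ℝ)) (d := fun j => (d j : ℝ)) ε ?_
    (fun j => by exact_mod_cast hd j)
  · simpa using h
  · have h := congrArg (fun M => M.map (Int.castRingHom ℝ)) hP
    simp only [Matrix.map_mul, diagonal_map (map_zero _)] at h
    exact h

theorem signature_gramReal :
    (Finset.univ.filter fun i => gramReal_isHermitian.eigenvalues i < 0).card = 10 ∧
    (Finset.univ.filter fun i => 0 < gramReal_isHermitian.eigenvalues i).card = 2 := by
  have hneg := card_le_card_eigenvalues (-1) negBasis_orthogonal (by decide)
  have hpos := card_le_card_eigenvalues 1 posBasis_orthogonal (by decide)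
  simp only [Int.cast_neg, Int.cast_one, neg_mul, one_mul, Left.neg_pos_iff] at hneg hpos
  have hdisj : Disjoint
      (Finset.univ.filter fun i => gramReal_isHermitian.eigenvalues i < 0)
      (Finset.univ.filter fun i => 0 < gramReal_isHermitian.eigenvalues i) :=
    Finset.disjoint_filter.2 fun _ _ h => h.not_gt
  have hle := Finset.card_le_univ (Finset.disjUnion _ _ hdisj)
  rw [Finset.card_disjUnion, Fintype.card_fin] at hle
  omega

end Z42


/-- The 12×12 Gram matrix `G` with `G_{ij} = a_{|i-j|}`,
`(a₀, …, a₁₁) = (-2, 0, 1, 0, 0, 1, 1, -1, -1, 0, 0, 0)`, is even unimodular of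
signature `(10; 2)`, and the companion matrix `C` of the 42nd cyclotomic polynomial
`Φ₄₂(X) = X¹² + X¹¹ - X⁹ - X⁸ + X⁶ - X⁴ - X³ + X + 1` is an isometry of `G` of
multiplicative order 42. -/
theorem Z42_quasicrystal_gram_matrix :
    let a : Fin 12 → ℤ := ![-2, 0, 1, 0, 0, 1, 1, -1, -1, 0, 0, 0]
    let G : Matrix (Fin 12) (Fin 12) ℤ :=
      Matrix.of fun i j =>
        a ⟨(i.val - j.val) + (j.val - i.val), by have := i.isLt; have := j.isLt; omega⟩
    -- last column of the companion matrix of Φ₄₂, i.e. `(-a₀, -a₁, …, -a₁₁)` for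
    -- `Φ₄₂ = X¹² + X¹¹ + 0·X¹⁰ - X⁹ - X⁸ + 0·X⁷ + X⁶ + 0·X⁵ - X⁴ - X³ + 0·X² + X + 1`
    let c : Fin 12 → ℤ := ![-1, -1, 0, 1, 1, 0, -1, 0, 1, 1, 0, -1]
    let C : Matrix (Fin 12) (Fin 12) ℤ :=
      Matrix.of fun i j => if j.val = 11 then c i else if i.val = j.val + 1 then 1 else 0
    |G.det| = 1 ∧
    (∀ i, Even (G i i)) ∧
    C.transpose * G * C = G ∧
    (C.charpoly = Polynomial.cyclotomic 42 ℤ ∧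
      C ^ 42 = 1 ∧ (∀ k, 0 < k → k < 42 → C ^ k ≠ 1)) ∧
    (∃ hH : (G.map (Int.cast : ℤ → ℝ)).IsHermitian,
      (Finset.univ.filter fun i => hH.eigenvalues i < 0).card = 10 ∧
      (Finset.univ.filter fun i => 0 < hH.eigenvalues i).card = 2) := by
  exact ⟨Z42.abs_det_gram, Z42.even_gram_diag, Z42.companion_isometry,
    ⟨Z42.charpoly_companion, Z42.companion_pow_eq_one, Z42.companion_pow_ne_one⟩,
    Z42.gramReal_isHermitian, Z42.signature_gramReal⟩
end

section
/- Let G be the 4×4 integer matrix with entries G_{ij} = a_{|i−j|} where (a_0, a_1, a_2, a_3) = (0, −1, −1, 1), i.e. G = [[0,−1,−1,1],[−1,0,−1,−1],[−1,−1,0,−1],[1,−1,−1,0]], and let C be the companion matrix of the 10th cyclotomic polynomial Φ₁₀(X) = X⁴ − X³ + X² − X + 1. Then: (i) det G = 5; (ii) every diagonal entry of G is even; (iii) Cᵀ G C = G; (iv) the real symmetric matrix G has exactly 2 positive and 2 negative eigenvalues; (v) the cokernel ℤ⁴ / (G · ℤ⁴) is isomorphic to ℤ/5ℤ (the discriminant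 group of the lattice is ℤ₅). (Hence G is the Gram matrix of the nonunimodular quasicrystal Γ₅^{2;2} of signature (2;2) with discriminant group ℤ₅.) -/
/-- Four real numbers with sum zero and positive product: two are positive, two are negative. -/
theorem card_pos_eq_two_and_card_neg_eq_two {a : Fin 4 → ℝ} (hsum : ∑ i, a i = 0)
    (hprod : 0 < ∏ i, a i) :
    (Finset.univ.filter fun i => 0 < a i).card = 2 ∧
      (Finset.univ.filter fun i => a i < 0).card = 2 := by
  have hne : ∀ i, a i ≠ 0 := fun i hi =>
    hprod.ne' (Finset.prod_eq_zero (Finset.mem_univ i) hi)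
  simp only [Fin.sum_univ_four, Fin.prod_univ_four] at hsum hprod
  simp only [Finset.card_filter, Fin.sum_univ_four]
  rcases lt_or_gt_of_ne (hne 0) with h0 | h0 <;> rcases lt_or_gt_of_ne (hne 1) with h1 | h1 <;>
  rcases lt_or_gt_of_ne (hne 2) with h2 | h2 <;> rcases lt_or_gt_of_ne (hne 3) with h3 | h3 <;>
  first
  | (exfalso; linarith)
  | (simp [h0, h1, h2, h3, h0.not_gt, h1.not_gt, h2.not_gt, h3.not_gt]; done)
  | (exfalso
     simp [mul_pos_iff, mul_neg_iff, h0, h1, h2, h3, h0.not_gt, h1.not_gt, h2.not_gt,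
       h3.not_gt] at hprod)

/-- A real symmetric `4 × 4` matrix of trace zero and positive determinant has signature `(2; 2)`. -/
theorem Matrix.IsHermitian.signature_of_trace_eq_zero_of_det_pos {A : Matrix (Fin 4) (Fin 4) ℝ}
    (hA : A.IsHermitian) (htrace : A.trace = 0) (hdet : 0 < A.det) :
    (Finset.univ.filter fun i => 0 < hA.eigenvalues i).card = 2 ∧
      (Finset.univ.filter fun i => hA.eigenvalues i < 0).card = 2 := by
  apply card_pos_eq_two_and_card_neg_eq_two
  · simpa [hA.trace_eq_sum_eigenvalues] using htrace
  · simpa [hA.det_eq_prod_eigenvalues] using hdet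

/-- The linear form `2x₀ + x₁ + x₂ + 2x₃` modulo `5`. -/
def discriminantForm : (Fin 4 → ℤ) →ₗ[ℤ] ZMod 5 :=
  (Algebra.linearMap ℤ (ZMod 5)).comp (Fintype.linearCombination ℤ ![2, 1, 1, 2])

theorem discriminantForm_apply (x : Fin 4 → ℤ) :
    discriminantForm x = ((2 * x 0 + x 1 + x 2 + 2 * x 3 : ℤ) : ZMod 5) := by
  simp [discriminantForm, Fintype.linearCombination_apply, Fin.sum_univ_four]
  ring

theorem discriminantForm_surjective : Function.Surjective discriminantForm := by
  intro z
  obtain ⟨n, rfl⟩ := ZMod.intCast_surjective z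
  exact ⟨![0, n, 0, 0], by simp [discriminantForm_apply]⟩

theorem range_mulVecLin_eq_ker_discriminantForm :
    LinearMap.range (!![0, -1, -1, 1; -1, 0, -1, -1; -1, -1, 0, -1; 1, -1, -1, 0] :
      Matrix (Fin 4) (Fin 4) ℤ).mulVecLin = LinearMap.ker discriminantForm := by
  ext x
  rw [LinearMap.mem_ker, discriminantForm_apply, ZMod.intCast_zmod_eq_zero_iff_dvd]
  constructor
  · rintro ⟨y, rfl⟩
    refine ⟨-(y 1 + y 2), ?_⟩
    simp [Matrix.mulVec, dotProduct, Fin.sum_univ_four]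
    ring
  · rintro ⟨k, hk⟩
    push_cast at hk
    refine ⟨![x 3 - k, 2 * k - x 0 - x 3 - x 2, 2 * k - x 0 - x 3 - x 1, x 0 - k], ?_⟩
    ext i
    fin_cases i <;> simp [Matrix.mulVec, dotProduct, Fin.sum_univ_four] <;> linarith


/-- The Gram matrix `G` with `G_{ij} = a_{|i-j|}`,
`(a₀, a₁, a₂, a₃) = (0, -1, -1, 1)`, satisfies: `det G = 5`, even diagonal, the companion
matrix `C` of `Φ₁₀(X) = X⁴ - X³ + X² - X + 1` is an isometry of `G`, `G` has signature
`(2; 2)`, and the discriminant group `ℤ⁴ / (G · ℤ⁴)` is isomorphic to `ℤ/5ℤ`. -/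
theorem Z5_quasicrystal_gram_matrix :
    let G : Matrix (Fin 4) (Fin 4) ℤ :=
      !![0, -1, -1, 1; -1, 0, -1, -1; -1, -1, 0, -1; 1, -1, -1, 0]
    let C : Matrix (Fin 4) (Fin 4) ℤ :=
      !![0, 0, 0, -1; 1, 0, 0, 1; 0, 1, 0, -1; 0, 0, 1, 1]
    G.det = 5 ∧
    (∀ i, Even (G i i)) ∧
    C.transpose * G * C = G ∧
    (∃ hH : (G.map (Int.cast : ℤ → ℝ)).IsHermitian,
      (Finset.univ.filter fun i => 0 < hH.eigenvalues i).card = 2 ∧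
      (Finset.univ.filter fun i => hH.eigenvalues i < 0).card = 2) ∧
    Nonempty (((Fin 4 → ℤ) ⧸ LinearMap.range G.mulVecLin) ≃+ ZMod 5) := by
  intro G C
  have hdet : G.det = 5 := by
    simp [G, Matrix.det_succ_row_zero, Fin.sum_univ_succ, Fin.succAbove]
  have hH : (G.map (Int.cast : ℤ → ℝ)).IsHermitian := by
    ext i j
    fin_cases i <;> fin_cases j <;> simp [G]
  refine ⟨hdet, by decide, by decide, ⟨hH, ?_⟩, ?_⟩
  · apply hH.signature_of_trace_eq_zero_of_det_pos
    · simp [G, Matrix.trace, Fin.sum_univ_four]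
    · have h : (G.map (Int.cast : ℤ → ℝ)).det = ((G.det : ℤ) : ℝ) :=
        ((Int.castRingHom ℝ).map_det G).symm
      rw [h, hdet]
      norm_num
  · exact ⟨((Submodule.quotEquivOfEq _ _ range_mulVecLin_eq_ker_discriminantForm).trans
      (discriminantForm.quotKerEquivOfSurjective discriminantForm_surjective)).toAddEquiv⟩
end

section
/- Let m ≥ 3 and let θ be a real φ(m) × φ(m) matrix whose characteristic polynomial is the m-th cyclotomic polynomial Φ_m (so the eigenvalues of θ are exactly the primitive m-th roots of unity, each simple). Then the real vector space W = {G : G is a real symmetric φ(m)×φ(m) matrix with θᵀ G θ = G} has dimension φ(m)/2. Moreover, for every pair of even non-negative integers (r, s) with r + s = φ(m), there exists G ∈ W that is nondegenerate with exactly r negative and s positive eigenvalues. -/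
open Matrix

/-- The real vector space of symmetric bilinear forms (Gram matrices) invariant under a
matrix `θ`, i.e. real symmetric `N × N` matrices `G` with `θᵀ G θ = G`. -/
def invariantSymmetricForms (N : ℕ) (θ : Matrix (Fin N) (Fin N) ℝ) :
    Submodule ℝ (Matrix (Fin N) (Fin N) ℝ) where
  carrier := {G | G.transpose = G ∧ θ.transpose * G * θ = G}
  add_mem' := by
    rintro a b ⟨ha1, ha2⟩ ⟨hb1, hb2⟩
    refine ⟨?_, ?_⟩
    · rw [Matrix.transpose_add, ha1, hb1]
    · rw [Matrix.mul_add, Matrix.add_mul, ha2, hb2]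
  zero_mem' := by
    refine ⟨?_, ?_⟩ <;> simp
  smul_mem' := by
    rintro c a ⟨ha1, ha2⟩
    refine ⟨?_, ?_⟩
    · rw [Matrix.transpose_smul, ha1]
    · rw [Matrix.mul_smul, Matrix.smul_mul, ha2]

open scoped ComplexConjugate

theorem conjTranspose_mul_diagonal_neg_mul {n ι : Type*} [Fintype ι] [DecidableEq ι]
    (C : Matrix ι n ℂ) (e : ι → ℝ) :
    Cᴴ * diagonal (fun i => ((-e i : ℝ) : ℂ)) * C = -(Cᴴ * diagonal (fun i => (e i : ℂ)) * C) := by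
  have : diagonal (fun i => ((-e i : ℝ) : ℂ)) = -diagonal (fun i => (e i : ℂ)) := by
    simp [diagonal_neg]
  rw [this, Matrix.mul_neg, Matrix.neg_mul]

section Inertia

variable {n ι κ : Type*} [Fintype n] [Fintype ι] [Fintype κ] [DecidableEq ι] [DecidableEq κ]

/-- The value at `x` of the Hermitian form `Aᴴ * diagonal c * A`. -/
theorem star_dotProduct_conjTranspose_mul_diagonal_mul_mulVec
    (A : Matrix ι n ℂ) (c : ι → ℝ) (x : n → ℂ) :
    star x ⬝ᵥ ((Aᴴ * diagonal (fun i => (c i : ℂ)) * A) *ᵥ x) =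
      ((∑ i, c i * Complex.normSq ((A *ᵥ x) i) : ℝ) : ℂ) := by
  rw [Matrix.mul_assoc, ← mulVec_mulVec, dotProduct_mulVec, ← star_mulVec, ← mulVec_mulVec]
  simp only [dotProduct, mulVec_diagonal, Pi.star_apply, Complex.ofReal_sum, Complex.ofReal_mul,
    Complex.normSq_eq_conj_mul_self]
  exact Finset.sum_congr rfl fun i _ => by simp only [starRingEnd_apply]; ring

/-- One half of Sylvester's law of inertia, for two diagonalizations of a Hermitian form. -/
theorem card_filter_neg_le_of_conjTranspose_mul_diagonal_mul_eq
    (A : Matrix ι n ℂ) (B : Matrix κ n ℂ) (c : ι → ℝ) (d : κ → ℝ)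
    (hA : Function.Injective A.mulVec) (hcard : Fintype.card ι = Fintype.card n)
    (h : Aᴴ * diagonal (fun i => (c i : ℂ)) * A = Bᴴ * diagonal (fun i => (d i : ℂ)) * B) :
    (Finset.univ.filter fun i => c i < 0).card ≤ (Finset.univ.filter fun j => d j < 0).card := by
  by_contra! hlt
  let f : (n → ℂ) →ₗ[ℂ] ({i // ¬ c i < 0} → ℂ) × ({j // d j < 0} → ℂ) :=
    ((LinearMap.funLeft ℂ ℂ Subtype.val).comp A.mulVecLin).prod
      ((LinearMap.funLeft ℂ ℂ Subtype.val).comp B.mulVecLin)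
  have hker : LinearMap.ker f ≠ ⊥ := by
    apply LinearMap.ker_ne_bot_of_finrank_lt
    have h1 := Fintype.card_subtype_compl (fun i => c i < 0)
    have h2 := Fintype.card_subtype_le (fun i => c i < 0)
    have h3 := Fintype.card_subtype (fun i => c i < 0)
    have h4 := Fintype.card_subtype (fun j => d j < 0)
    simp only [Module.finrank_prod, Module.finrank_fintype_fun_eq_card]
    omega
  obtain ⟨x, hx, hx0⟩ := (Submodule.ne_bot_iff _).1 hker
  have hx' : f x = 0 := hx
  have hxA : ∀ i, ¬ c i < 0 → (A *ᵥ x) i = 0 := fun i hi =>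
    congrFun (congrArg Prod.fst hx') ⟨i, hi⟩
  have hxB : ∀ j, d j < 0 → (B *ᵥ x) j = 0 := fun j hj =>
    congrFun (congrArg Prod.snd hx') ⟨j, hj⟩
  have hAx : A *ᵥ x ≠ 0 := fun h0 => hx0 (hA (h0.trans (mulVec_zero A).symm))
  obtain ⟨k, hk⟩ := Function.ne_iff.1 hAx
  have hneg : ∑ i, c i * Complex.normSq ((A *ᵥ x) i) < 0 := by
    refine Finset.sum_neg' (fun i _ => ?_) ⟨k, Finset.mem_univ k, ?_⟩
    · by_cases hi : c i < 0
      · exact mul_nonpos_of_nonpos_of_nonneg hi.le (Complex.normSq_nonneg _)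
      · simp [hxA i hi]
    · have hck : c k < 0 := by
        by_contra hck
        exact hk (hxA k hck)
      exact mul_neg_of_neg_of_pos hck (Complex.normSq_pos.2 hk)
  have hpos : 0 ≤ ∑ j, d j * Complex.normSq ((B *ᵥ x) j) := by
    refine Finset.sum_nonneg fun j _ => ?_
    by_cases hj : d j < 0
    · simp [hxB j hj]
    · exact mul_nonneg (not_lt.1 hj) (Complex.normSq_nonneg _)
  have key := star_dotProduct_conjTranspose_mul_diagonal_mul_mulVec A c x
  rw [h, star_dotProduct_conjTranspose_mul_diagonal_mul_mulVec, Complex.ofReal_inj] at key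
  linarith

/-- Sylvester's law of inertia for the negative index. -/
theorem card_filter_neg_eq_of_conjTranspose_mul_diagonal_mul_eq
    (A : Matrix ι n ℂ) (B : Matrix κ n ℂ) (c : ι → ℝ) (d : κ → ℝ)
    (hA : Function.Injective A.mulVec) (hB : Function.Injective B.mulVec)
    (hι : Fintype.card ι = Fintype.card n) (hκ : Fintype.card κ = Fintype.card n)
    (h : Aᴴ * diagonal (fun i => (c i : ℂ)) * A = Bᴴ * diagonal (fun i => (d i : ℂ)) * B) :
    (Finset.univ.filter fun i => c i < 0).card = (Finset.univ.filter fun j => d j < 0).card :=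
  le_antisymm (card_filter_neg_le_of_conjTranspose_mul_diagonal_mul_eq A B c d hA hι h)
    (card_filter_neg_le_of_conjTranspose_mul_diagonal_mul_eq B A d c hB hκ h.symm)

/-- Sylvester's law of inertia for the positive index. -/
theorem card_filter_pos_eq_of_conjTranspose_mul_diagonal_mul_eq
    (A : Matrix ι n ℂ) (B : Matrix κ n ℂ) (c : ι → ℝ) (d : κ → ℝ)
    (hA : Function.Injective A.mulVec) (hB : Function.Injective B.mulVec)
    (hι : Fintype.card ι = Fintype.card n) (hκ : Fintype.card κ = Fintype.card n)
    (h : Aᴴ * diagonal (fun i => (c i : ℂ)) * A = Bᴴ * diagonal (fun i => (d i : ℂ)) * B) :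
    (Finset.univ.filter fun i => 0 < c i).card = (Finset.univ.filter fun j => 0 < d j).card := by
  simpa using card_filter_neg_eq_of_conjTranspose_mul_diagonal_mul_eq A B (fun i => -c i)
    (fun j => -d j) hA hB hι hκ (by
      simp only [conjTranspose_mul_diagonal_neg_mul, h])

end Inertia

theorem map_ofReal_mul {l m n : Type*} [Fintype m] (A : Matrix l m ℝ) (B : Matrix m n ℝ) :
    (A * B).map Complex.ofReal = A.map Complex.ofReal * B.map Complex.ofReal :=
  Matrix.map_mul (f := Complex.ofRealHom)

theorem map_ofReal_conjTranspose {m n : Type*} (A : Matrix m n ℝ) :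
    (A.map Complex.ofReal)ᴴ = Aᵀ.map Complex.ofReal := by
  ext i j
  simp

theorem map_ofReal_injective {m n : Type*} :
    Function.Injective fun A : Matrix m n ℝ => A.map Complex.ofReal :=
  Matrix.map_injective Complex.ofReal_injective

/-- A real Hermitian matrix, viewed over `ℂ`, is congruent to its diagonal of eigenvalues. -/
theorem exists_map_ofReal_eq_conjTranspose_mul_diagonal_eigenvalues_mul
    {n : Type*} [Fintype n] [DecidableEq n] {G : Matrix n n ℝ} (hG : G.IsHermitian) :
    ∃ B : Matrix n n ℂ, Function.Injective B.mulVec ∧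
      G.map Complex.ofReal = Bᴴ * diagonal (fun i => (hG.eigenvalues i : ℂ)) * B := by
  let U : Matrix n n ℝ := hG.eigenvectorUnitary
  have hU : U * star U = 1 := Unitary.mul_star_self_of_mem hG.eigenvectorUnitary.2
  have hspec : G = U * diagonal hG.eigenvalues * star U := by
    simpa [Unitary.conjStarAlgAut_apply] using hG.spectral_theorem
  refine ⟨(star U).map Complex.ofReal, ?_, ?_⟩
  · have h1 : U.map Complex.ofReal * (star U).map Complex.ofReal = 1 := by
      rw [← map_ofReal_mul, hU]
      simp
    exact Function.LeftInverse.injective (g := (U.map Complex.ofReal).mulVec) fun x => by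
      rw [mulVec_mulVec, h1, one_mulVec]
  · have h2 : ((star U).map Complex.ofReal)ᴴ = U.map Complex.ofReal := by
      ext i j
      simp [star_eq_conjTranspose]
    have h3 : diagonal (fun i => (hG.eigenvalues i : ℂ)) =
        (diagonal hG.eigenvalues).map Complex.ofReal := by
      rw [diagonal_map Complex.ofReal_zero]
    rw [h2, h3, ← map_ofReal_mul, ← map_ofReal_mul, ← hspec]

/-- A real matrix `θ` diagonalized over `ℂ` by a basis of eigenvectors (the columns of
`basis`) for distinct eigenvalues on the unit circle, indexed in complex-conjugate pairs. -/
structure ConjPairDiagonalization {n : Type*} [Fintype n] [DecidableEq n]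
    (θ : Matrix n n ℝ) (H : Type*) [Fintype H] [DecidableEq H] where
  /-- The eigenvalues. -/
  eigenvalue : H × Bool → ℂ
  /-- The matrix whose columns are the eigenvectors. -/
  basis : Matrix n (H × Bool) ℂ
  /-- The inverse of `basis`. -/
  dual : Matrix (H × Bool) n ℂ
  eigenvalue_injective : Function.Injective eigenvalue
  conj_mul_eigenvalue : ∀ i, conj (eigenvalue i) * eigenvalue i = 1
  basis_mul_dual : basis * dual = 1
  dual_mul_basis : dual * basis = 1
  map_mul_basis : θ.map Complex.ofReal * basis = basis * diagonal eigenvalue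
  conj_basis : ∀ a h b, conj (basis a (h, b)) = basis a (h, !b)

namespace ConjPairDiagonalization

variable {n : Type*} [Fintype n] [DecidableEq n] {θ : Matrix n n ℝ}
  {H : Type*} [Fintype H] [DecidableEq H] (E : ConjPairDiagonalization θ H)

theorem conj_dual (h : H) (b : Bool) (a : n) : conj (E.dual (h, b) a) = E.dual (h, !b) a := by
  let σ : H × Bool ≃ H × Bool := Equiv.prodCongr (Equiv.refl H) Equiv.boolNot
  have hQ : E.basis.map (starRingEnd ℂ) = E.basis.submatrix id σ := by
    ext a ⟨h, b⟩
    exact E.conj_basis a h b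
  have h1 : E.dual.map (starRingEnd ℂ) * E.basis.submatrix id σ = 1 := by
    rw [← hQ, ← Matrix.map_mul, E.dual_mul_basis]
    simp
  have h2 : E.basis.submatrix id σ * E.dual.submatrix σ id = 1 := by
    rw [submatrix_mul_equiv, E.basis_mul_dual, submatrix_id_id]
  have h3 : E.dual.map (starRingEnd ℂ) = E.dual.submatrix σ id := by
    rw [← Matrix.mul_one (E.dual.map _), ← h2, ← Matrix.mul_assoc, h1, Matrix.one_mul]
  exact congrFun (congrFun h3 (h, b)) a

/-- The invariant real form that is diagonal in the eigenbasis, with coefficient `c h` on the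
`h`-th conjugate pair. -/
noncomputable def form (c : H → ℝ) : Matrix n n ℝ :=
  (E.dualᴴ * diagonal (fun i : H × Bool => (c i.1 : ℂ)) * E.dual).map Complex.re

theorem map_form (c : H → ℝ) :
    (E.form c).map Complex.ofReal =
      E.dualᴴ * diagonal (fun i : H × Bool => (c i.1 : ℂ)) * E.dual := by
  let σ : H × Bool ≃ H × Bool := Equiv.prodCongr (Equiv.refl H) Equiv.boolNot
  ext a b
  simp only [form, map_apply]
  rw [← Complex.conj_eq_iff_re, mul_apply]
  simp only [mul_diagonal, conjTranspose_apply, map_sum, map_mul, Complex.conj_ofReal,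
    ← starRingEnd_apply, Complex.conj_conj]
  exact Fintype.sum_equiv σ _ _ fun ⟨h, b⟩ => by simp [σ, ← conj_dual]

theorem basis_conj_map_form (c : H → ℝ) :
    E.basisᴴ * (E.form c).map Complex.ofReal * E.basis =
      diagonal (fun i : H × Bool => (c i.1 : ℂ)) := by
  have h1 : E.basisᴴ * E.dualᴴ = 1 := by
    rw [← conjTranspose_mul, E.dual_mul_basis, conjTranspose_one]
  rw [map_form]
  calc _ = (E.basisᴴ * E.dualᴴ) * diagonal (fun i : H × Bool => (c i.1 : ℂ)) *
          (E.dual * E.basis) := by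
        simp only [Matrix.mul_assoc]
    _ = _ := by rw [h1, E.dual_mul_basis, Matrix.one_mul, Matrix.mul_one]

theorem dual_conj_basis_conj (M : Matrix n n ℂ) :
    E.dualᴴ * (E.basisᴴ * M * E.basis) * E.dual = M := by
  have h1 : E.dualᴴ * E.basisᴴ = 1 := by
    rw [← conjTranspose_mul, E.basis_mul_dual, conjTranspose_one]
  calc _ = (E.dualᴴ * E.basisᴴ) * M * (E.basis * E.dual) := by simp only [Matrix.mul_assoc]
    _ = _ := by rw [h1, E.basis_mul_dual, Matrix.one_mul, Matrix.mul_one]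

theorem basis_conj_invariant (M : Matrix n n ℂ) :
    E.basisᴴ * ((θ.map Complex.ofReal)ᴴ * M * θ.map Complex.ofReal) * E.basis =
      (diagonal E.eigenvalue)ᴴ * (E.basisᴴ * M * E.basis) * diagonal E.eigenvalue := by
  calc _ = (θ.map Complex.ofReal * E.basis)ᴴ * M * (θ.map Complex.ofReal * E.basis) := by
        simp only [conjTranspose_mul, Matrix.mul_assoc]
    _ = _ := by
        rw [E.map_mul_basis]
        simp only [conjTranspose_mul, Matrix.mul_assoc]

theorem form_transpose (c : H → ℝ) : (E.form c)ᵀ = E.form c := by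
  apply map_ofReal_injective
  simp only [← map_ofReal_conjTranspose, map_form, conjTranspose_mul, diagonal_conjTranspose,
    conjTranspose_conjTranspose, Matrix.mul_assoc]
  congr 3
  ext i
  simp

theorem form_invariant (c : H → ℝ) : θᵀ * E.form c * θ = E.form c := by
  apply map_ofReal_injective
  have h1 : (θᵀ * E.form c * θ).map Complex.ofReal =
      (θ.map Complex.ofReal)ᴴ * (E.form c).map Complex.ofReal * θ.map Complex.ofReal := by
    rw [map_ofReal_conjTranspose, map_ofReal_mul, map_ofReal_mul]
  simp only [h1]
  rw [← E.dual_conj_basis_conj (_ * _), E.basis_conj_invariant, basis_conj_map_form, E.map_form,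
    diagonal_conjTranspose, diagonal_mul_diagonal, diagonal_mul_diagonal]
  congr 3
  ext i
  have := E.conj_mul_eigenvalue i
  rw [Pi.star_apply, ← starRingEnd_apply]
  linear_combination (c i.1 : ℂ) * this

/-- The coefficient of a real matrix on the `h`-th conjugate pair. -/
noncomputable def coeff : Matrix n n ℝ →ₗ[ℝ] (H → ℝ) where
  toFun G h := ((E.basisᴴ * G.map Complex.ofReal * E.basis) (h, false) (h, false)).re
  map_add' G K := by
    ext h
    simp [Matrix.map_add, Matrix.mul_add, Matrix.add_mul]
  map_smul' r G := by
    ext h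
    have : (r • G).map Complex.ofReal = (r : ℂ) • G.map Complex.ofReal := by
      ext
      simp
    simp [this]

theorem coeff_form (c : H → ℝ) : E.coeff (E.form c) = c := by
  ext h
  simp [coeff, basis_conj_map_form]

theorem form_coeff {G : Matrix n n ℝ} (hsymm : Gᵀ = G) (hinv : θᵀ * G * θ = G) :
    E.form (E.coeff G) = G := by
  apply map_ofReal_injective
  set K := E.basisᴴ * G.map Complex.ofReal * E.basis with hK
  have hherm : Kᴴ = K := by
    simp only [hK, conjTranspose_mul, conjTranspose_conjTranspose, Matrix.mul_assoc,
      map_ofReal_conjTranspose, hsymm]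
  have hinv' : (θ.map Complex.ofReal)ᴴ * G.map Complex.ofReal * θ.map Complex.ofReal =
      G.map Complex.ofReal := by
    conv_rhs => rw [← hinv]
    rw [map_ofReal_conjTranspose, map_ofReal_mul, map_ofReal_mul]
  have hKinv : (diagonal E.eigenvalue)ᴴ * K * diagonal E.eigenvalue = K := by
    rw [hK, ← basis_conj_invariant, hinv']
  have hoff : ∀ i j, i ≠ j → K i j = 0 := by
    intro i j hij
    have h1 := congrFun (congrFun hKinv i) j
    rw [mul_diagonal, diagonal_conjTranspose, diagonal_mul, Pi.star_apply,
      ← starRingEnd_apply] at h1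
    by_contra h0
    refine hij (E.eigenvalue_injective ?_)
    have h2 : conj (E.eigenvalue i) * E.eigenvalue j = 1 :=
      mul_right_cancel₀ h0 (by linear_combination h1)
    have h3 := E.conj_mul_eigenvalue i
    exact mul_left_cancel₀ (left_ne_zero_of_mul_eq_one h3) (h3.trans h2.symm)
  have hconj : ∀ h b, conj (K (h, b) (h, b)) = K (h, !b) (h, !b) := by
    intro h b
    simp [hK, mul_apply, E.conj_basis, Finset.sum_mul, ← starRingEnd_apply]
  have hreal : ∀ i, conj (K i i) = K i i := fun i => congrFun (congrFun hherm i) i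
  have hdiag : K = diagonal (fun i : H × Bool => (E.coeff G i.1 : ℂ)) := by
    ext ⟨h, b⟩ j
    by_cases hj : (h, b) = j
    · subst hj
      have hf : K (h, b) (h, b) = K (h, false) (h, false) := by
        cases b
        · rfl
        · rw [← hreal (h, false), hconj]
          rfl
      rw [diagonal_apply_eq, hf]
      exact (Complex.conj_eq_iff_re.1 (hreal _)).symm
    · rw [diagonal_apply_ne _ hj, hoff _ _ hj]
  simp only [E.map_form]
  rw [← hdiag, hK, dual_conj_basis_conj]

theorem card_eq (E : ConjPairDiagonalization θ H) : Fintype.card (H × Bool) = Fintype.card n := by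
  refine le_antisymm ?_ ?_
  · have := E.basis.rank_le_card_height
    have h := rank_mul_le_right E.dual E.basis
    rw [E.dual_mul_basis, rank_one] at h
    exact h.trans this
  · have h := rank_mul_le_left E.basis E.dual
    rw [E.basis_mul_dual, rank_one] at h
    exact h.trans E.basis.rank_le_card_width

theorem dual_mulVec_injective : Function.Injective E.dual.mulVec :=
  Function.LeftInverse.injective (g := E.basis.mulVec) fun x => by
    rw [mulVec_mulVec, E.basis_mul_dual, one_mulVec]

/-- The eigenvalues of `E.form c` have the signs of `c`, each counted twice. -/
theorem card_eigenvalues_form (c : H → ℝ) (hH : (E.form c).IsHermitian) :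
    (Finset.univ.filter fun i => hH.eigenvalues i < 0).card =
        2 * (Finset.univ.filter fun h => c h < 0).card ∧
      (Finset.univ.filter fun i => 0 < hH.eigenvalues i).card =
        2 * (Finset.univ.filter fun h => 0 < c h).card := by
  obtain ⟨B, hB, hGB⟩ := exists_map_ofReal_eq_conjTranspose_mul_diagonal_eigenvalues_mul hH
  rw [E.map_form] at hGB
  have hcount : ∀ p : H → Prop, ∀ [DecidablePred p],
      (Finset.univ.filter fun i : H × Bool => p i.1).card = 2 * (Finset.univ.filter p).card := by
    intro p _
    have : (Finset.univ.filter fun i : H × Bool => p i.1) =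
        Finset.univ.filter p ×ˢ Finset.univ := by
      ext
      simp
    rw [this, Finset.card_product, Finset.card_univ, Fintype.card_bool, mul_comm]
  rw [← hcount, ← hcount]
  exact ⟨(card_filter_neg_eq_of_conjTranspose_mul_diagonal_mul_eq E.dual B (fun i => c i.1) _
      E.dual_mulVec_injective hB E.card_eq rfl hGB).symm,
    (card_filter_pos_eq_of_conjTranspose_mul_diagonal_mul_eq E.dual B (fun i => c i.1) _
      E.dual_mulVec_injective hB E.card_eq rfl hGB).symm⟩

end ConjPairDiagonalization

/-- The number of conjugate pairs is the dimension of the space of invariant forms. -/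
theorem finrank_invariantSymmetricForms {N : ℕ} {θ : Matrix (Fin N) (Fin N) ℝ}
    {H : Type*} [Fintype H] [DecidableEq H] (E : ConjPairDiagonalization θ H) :
    Module.finrank ℝ (invariantSymmetricForms N θ) = Fintype.card H := by
  let f : invariantSymmetricForms N θ →ₗ[ℝ] (H → ℝ) :=
    E.coeff.comp (invariantSymmetricForms N θ).subtype
  have hf : Function.Bijective f := by
    refine ⟨fun G K hGK => Subtype.ext ?_, fun c => ?_⟩
    · rw [← E.form_coeff G.2.1 G.2.2, ← E.form_coeff K.2.1 K.2.2]
      exact congrArg E.form hGK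
    · exact ⟨⟨E.form c, E.form_transpose c, E.form_invariant c⟩, E.coeff_form c⟩
  rw [(LinearEquiv.ofBijective f hf).finrank_eq, Module.finrank_fintype_fun_eq_card]

/-- The primitive `m`-th roots of unity in the upper half plane. -/
noncomputable abbrev upperPrimitiveRoots (m : ℕ) : Finset ℂ :=
  (primitiveRoots m ℂ).filter fun z => 0 < z.im

/-- The root of unity encoded by an element of the upper half plane and a conjugation flag. -/
noncomputable def conjPairRoot {m : ℕ} (i : upperPrimitiveRoots m × Bool) : ℂ :=
  if i.2 then conj (i.1 : ℂ) else i.1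

theorem conjPairRoot_injective {m : ℕ} : Function.Injective (conjPairRoot (m := m)) := by
  rintro ⟨⟨z, hz⟩, b⟩ ⟨⟨w, hw⟩, b'⟩ h
  have hz' := (Finset.mem_filter.1 hz).2
  have hw' := (Finset.mem_filter.1 hw).2
  have him := congrArg Complex.im h
  cases b <;> cases b' <;> simp [conjPairRoot] at h him ⊢
  · exact h
  · linarith
  · linarith
  · exact (starRingEnd ℂ).injective h

theorem IsPrimitiveRoot.complex_conj {m : ℕ} {z : ℂ} (hz : IsPrimitiveRoot z m) :
    IsPrimitiveRoot (conj z) m :=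
  hz.map_of_injective (f := starRingEnd ℂ) (starRingEnd ℂ).injective

theorem isPrimitiveRoot_conjPairRoot {m : ℕ} (i : upperPrimitiveRoots m × Bool) :
    IsPrimitiveRoot (conjPairRoot i) m := by
  obtain ⟨⟨z, hz⟩, b⟩ := i
  have hz' := isPrimitiveRoot_of_mem_primitiveRoots (Finset.mem_filter.1 hz).1
  cases b
  · simpa [conjPairRoot] using hz'
  · simpa [conjPairRoot] using hz'.complex_conj

theorem IsPrimitiveRoot.im_ne_zero {m : ℕ} (hm : 3 ≤ m) {z : ℂ} (hz : IsPrimitiveRoot z m) :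
    z.im ≠ 0 := by
  intro him
  have hn := hz.norm'_eq_one (by omega)
  have hsq : z ^ 2 = 1 := by
    have h1 := Complex.mul_conj' z
    rw [Complex.conj_eq_iff_im.2 him, hn] at h1
    simpa [sq] using h1
  have := Nat.le_of_dvd two_pos (hz.dvd_of_pow_eq_one 2 hsq)
  omega

theorem card_upperPrimitiveRoots_prod_bool {m : ℕ} (hm : 3 ≤ m) :
    Fintype.card (upperPrimitiveRoots m × Bool) = m.totient := by
  rw [← (Complex.isPrimitiveRoot_exp m (by omega)).card_primitiveRoots, ← Fintype.card_coe]
  refine Fintype.card_of_bijective (f := fun i => ⟨conjPairRoot i,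
    (mem_primitiveRoots (by omega)).2 (isPrimitiveRoot_conjPairRoot i)⟩) ⟨?_, ?_⟩
  · intro i j h
    exact conjPairRoot_injective (congrArg Subtype.val h)
  · rintro ⟨z, hz⟩
    have hz' := isPrimitiveRoot_of_mem_primitiveRoots hz
    rcases lt_or_gt_of_ne (hz'.im_ne_zero hm) with h | h
    · refine ⟨(⟨conj z, Finset.mem_filter.2
        ⟨(mem_primitiveRoots (by omega)).2 hz'.complex_conj, by simpa using h⟩⟩, true), ?_⟩
      simp [conjPairRoot]
    · exact ⟨(⟨z, Finset.mem_filter.2 ⟨hz, h⟩⟩, false), by simp [conjPairRoot]⟩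

/-- A real matrix with characteristic polynomial `Φ_m` is diagonalizable over `ℂ`, with the
eigenvalues in conjugate pairs. -/
theorem nonempty_conjPairDiagonalization {m : ℕ} (hm : 3 ≤ m)
    (θ : Matrix (Fin m.totient) (Fin m.totient) ℝ)
    (hchar : θ.charpoly = Polynomial.cyclotomic m ℝ) :
    Nonempty (ConjPairDiagonalization θ (upperPrimitiveRoots m)) := by
  have : NeZero (m : ℂ) := ⟨by exact_mod_cast (by omega : m ≠ 0)⟩
  set T := θ.map Complex.ofReal with hT
  have hTchar : T.charpoly = Polynomial.cyclotomic m ℂ := by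
    exact (charpoly_map θ Complex.ofRealHom).trans (by rw [hchar, Polynomial.map_cyclotomic])
  have hex : ∀ h : upperPrimitiveRoots m, ∃ v : Fin m.totient → ℂ, v ≠ 0 ∧
      T *ᵥ v = (h : ℂ) • v := by
    intro h
    have hp := isPrimitiveRoot_of_mem_primitiveRoots (Finset.mem_filter.1 h.2).1
    have hroot : T.charpoly.IsRoot h := by
      rw [hTchar, Polynomial.isRoot_cyclotomic_iff]
      exact hp
    have hev : Module.End.HasEigenvalue (Matrix.toLin' T) (h : ℂ) := by
      rw [Module.End.hasEigenvalue_iff_isRoot_charpoly, Matrix.charpoly_toLin']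
      exact hroot
    obtain ⟨v, hv⟩ := hev.exists_hasEigenvector
    exact ⟨v, hv.2, by simpa using hv.apply_eq_smul⟩
  choose u hu0 hu using hex
  let v : upperPrimitiveRoots m × Bool → Fin m.totient → ℂ :=
    fun i => if i.2 then star (u i.1) else u i.1
  have hv : ∀ i, T *ᵥ v i = conjPairRoot i • v i := by
    rintro ⟨h, b⟩
    cases b
    · simpa [v, conjPairRoot] using hu h
    · have h1 : T *ᵥ star (u h) = star (T *ᵥ u h) := by
        ext a
        simp [hT, mulVec, dotProduct]
      simp [v, conjPairRoot, h1, hu h]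
  have hv0 : ∀ i, v i ≠ 0 := by
    rintro ⟨h, b⟩
    cases b
    · simpa [v] using hu0 h
    · simpa [v] using hu0 h
  have hli : LinearIndependent ℂ v :=
    Module.End.eigenvectors_linearIndependent' (Matrix.toLin' T) conjPairRoot
      conjPairRoot_injective v fun i =>
        ⟨Module.End.mem_eigenspace_iff.2 (by simpa using hv i), hv0 i⟩
  have hcard : Fintype.card (upperPrimitiveRoots m × Bool) =
      Module.finrank ℂ (Fin m.totient → ℂ) := by
    rw [card_upperPrimitiveRoots_prod_bool hm, Module.finrank_fin_fun]
  have hne : Nonempty (upperPrimitiveRoots m × Bool) := by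
    rw [← Fintype.card_pos_iff, card_upperPrimitiveRoots_prod_bool hm]
    exact Nat.totient_pos.2 (by omega)
  let b := basisOfLinearIndependentOfCardEqFinrank hli hcard
  let e := Pi.basisFun ℂ (Fin m.totient)
  have hb : ∀ a i, e.toMatrix b a i = v i a := by
    intro a i
    simp [e, b, Module.Basis.toMatrix_apply]
  exact ⟨{
    eigenvalue := conjPairRoot
    basis := e.toMatrix b
    dual := b.toMatrix e
    eigenvalue_injective := conjPairRoot_injective
    conj_mul_eigenvalue := fun i => by
      rw [Complex.conj_mul', (isPrimitiveRoot_conjPairRoot i).norm'_eq_one (by omega)]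
      simp
    basis_mul_dual := e.toMatrix_mul_toMatrix_flip b
    dual_mul_basis := b.toMatrix_mul_toMatrix_flip e
    map_mul_basis := by
      ext a i
      rw [mul_diagonal, hb, mul_apply]
      simp only [hb]
      exact (congrFun (hv i) a).trans (mul_comm _ _)
    conj_basis := by
      intro a h c
      rw [hb, hb]
      cases c <;> simp [v] }⟩

/-- Let `m ≥ 3` and let `θ` be a real `φ(m) × φ(m)` matrix with
characteristic polynomial `Φ_m`. Then the space of real symmetric matrices `G` with
`θᵀ G θ = G` has dimension `φ(m)/2`, and for every pair of even naturals `(r, s)` with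
`r + s = φ(m)` it contains a nondegenerate `G` with exactly `r` negative and `s` positive
eigenvalues. -/
theorem invariantSymmetricForms_finrank_and_signatures
    (m : ℕ) (hm : 3 ≤ m) (θ : Matrix (Fin m.totient) (Fin m.totient) ℝ)
    (hchar : θ.charpoly = Polynomial.cyclotomic m ℝ) :
    Module.finrank ℝ (invariantSymmetricForms m.totient θ) = m.totient / 2 ∧
    ∀ r s : ℕ, Even r → Even s → r + s = m.totient →
      ∃ G ∈ invariantSymmetricForms m.totient θ, G.det ≠ 0 ∧
        ∃ hH : G.IsHermitian,
          (Finset.univ.filter fun i => hH.eigenvalues i < 0).card = r ∧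
          (Finset.univ.filter fun i => 0 < hH.eigenvalues i).card = s := by
  obtain ⟨E⟩ := nonempty_conjPairDiagonalization hm θ hchar
  have hcard := card_upperPrimitiveRoots_prod_bool hm
  rw [Fintype.card_prod, Fintype.card_bool] at hcard
  refine ⟨by rw [finrank_invariantSymmetricForms E]; omega, ?_⟩
  rintro r s ⟨r, rfl⟩ ⟨s, rfl⟩ hrs
  obtain ⟨S, -, hS⟩ := Finset.exists_subset_card_eq
    (s := (Finset.univ : Finset (upperPrimitiveRoots m))) (n := r)
    (by rw [Finset.card_univ]; omega)
  let c : upperPrimitiveRoots m → ℝ := fun h => if h ∈ S then -1 else 1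
  have hneg : (Finset.univ.filter fun h => c h < 0) = S := by
    ext h
    by_cases hh : h ∈ S <;> simp [c, hh]
  have hpos : (Finset.univ.filter fun h => 0 < c h) = Sᶜ := by
    ext h
    by_cases hh : h ∈ S <;> simp [c, hh]
  have hH : (E.form c).IsHermitian := by
    rw [IsHermitian, conjTranspose_eq_transpose_of_trivial, E.form_transpose]
  obtain ⟨h1, h2⟩ := E.card_eigenvalues_form c hH
  rw [hneg, hS] at h1
  rw [hpos, Finset.card_compl, hS] at h2
  refine ⟨E.form c, ⟨E.form_transpose c, E.form_invariant c⟩, ?_, hH, by omega, by omega⟩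
  rw [hH.det_eq_prod_eigenvalues]
  refine Finset.prod_ne_zero_iff.2 fun i _ hi => ?_
  have hi' : hH.eigenvalues i = 0 := by simpa using hi
  have hdisj : Disjoint (Finset.univ.filter fun i => hH.eigenvalues i < 0)
      (Finset.univ.filter fun i => 0 < hH.eigenvalues i) :=
    Finset.disjoint_filter.2 fun j _ hj => hj.not_gt
  have hlt := Finset.card_lt_univ_of_notMem (s := (Finset.univ.filter fun i =>
    hH.eigenvalues i < 0) ∪ Finset.univ.filter fun i => 0 < hH.eigenvalues i) (x := i)
    (by simp [hi'])
  rw [Finset.card_union_of_disjoint hdisj, h1, h2, Fintype.card_fin] at hlt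
  omega
end

section
/- Let m ≥ 3 and let θ be a real n×n matrix (n = φ(m)) whose characteristic polynomial is the m-th cyclotomic polynomial Φ_m. Suppose G is a nondegenerate real symmetric n×n matrix with θᵀ G θ = G, and let r and s be the numbers of negative and positive eigenvalues of G respectively. Then both r and s are even. -/
/-- The determinant of a real skew-symmetric matrix is nonnegative. -/
theorem Matrix.det_nonneg_of_transpose_eq_neg {n : Type*} [Fintype n] [DecidableEq n]
    (A : Matrix n n ℝ) (hA : A.transpose = -A) : 0 ≤ A.det := by
  by_contra! hneg
  let f : ℝ → ℝ := fun t => ((1 - t) • (1 : Matrix n n ℝ) + t • A).det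
  have hf : Continuous f := by
    apply Continuous.matrix_det
    fun_prop
  have hf0 : f 0 = 1 := by simp [f]
  have hf1 : f 1 = A.det := by simp [f]
  obtain ⟨t, ⟨ht0, ht1⟩, ht⟩ : (0 : ℝ) ∈ f '' Set.Icc 0 1 :=
    intermediate_value_Icc' zero_le_one hf.continuousOn
      ⟨by rw [hf1]; exact hneg.le, by rw [hf0]; exact zero_le_one⟩
  have htlt : t < 1 := by
    refine lt_of_le_of_ne ht1 ?_
    rintro rfl
    rw [hf1] at ht
    exact hneg.ne ht
  obtain ⟨v, hv, hv0⟩ := Matrix.exists_mulVec_eq_zero_iff.mpr ht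
  have hskew : v ⬝ᵥ A.mulVec v = 0 := by
    have h : v ⬝ᵥ A.mulVec v = -(v ⬝ᵥ A.mulVec v) := by
      conv_lhs => rw [Matrix.dotProduct_mulVec, ← Matrix.mulVec_transpose, hA,
        Matrix.neg_mulVec, neg_dotProduct, dotProduct_comm]
    linarith
  have hsum : (1 - t) * (v ⬝ᵥ v) = 0 := by
    have h := congrArg (v ⬝ᵥ ·) hv0
    simpa [Matrix.add_mulVec, Matrix.smul_mulVec, hskew] using h
  rcases mul_eq_zero.mp hsum with h | h
  · linarith
  · exact hv (dotProduct_self_eq_zero.mp h)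

/-- A finite product of real numbers is positive only if it has an even number of negative
factors. -/
theorem Finset.even_card_filter_neg_of_prod_pos {ι : Type*} (s : Finset ι) (f : ι → ℝ)
    (h : 0 < ∏ i ∈ s, f i) : Even (s.filter fun i => f i < 0).card := by
  rw [← Finset.prod_filter_mul_prod_filter_not s (fun i => f i < 0)] at h
  have hnot : 0 ≤ ∏ i ∈ s with ¬f i < 0, f i :=
    Finset.prod_nonneg fun i hi => not_lt.mp (Finset.mem_filter.mp hi).2
  have hpos : 0 < ∏ i ∈ s with f i < 0, f i := pos_of_mul_pos_left h hnot
  have habs : 0 < ∏ i ∈ s with f i < 0, -f i :=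
    Finset.prod_pos fun i hi => neg_pos.mpr (Finset.mem_filter.mp hi).2
  rw [Finset.prod_neg] at habs
  by_contra hodd
  rw [(Nat.not_even_iff_odd.mp hodd).neg_one_pow] at habs
  linarith

/-- If a matrix of even size has a characteristic polynomial that is positive on the real line,
every nondegenerate symmetric form it preserves has positive determinant. -/
theorem Matrix.det_pos_of_isometry {n : Type*} [Fintype n] [DecidableEq n]
    (θ G : Matrix n n ℝ) (hn : Even (Fintype.card n))
    (hχ : ∀ x : ℝ, 0 < θ.charpoly.eval x) (hsym : G.transpose = G) (hnd : G.det ≠ 0)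
    (hinv : θ.transpose * G * θ = G) : 0 < G.det := by
  have hpos : ∀ x : ℝ, 0 < (θ - Matrix.scalar n x).det := fun x => by
    rw [← neg_sub, Matrix.det_neg, hn.neg_one_pow, one_mul, ← Matrix.eval_charpoly]
    exact hχ x
  have h0 : 0 < θ.det := by simpa using hpos 0
  have h1 : 0 < (θ - 1).det := by simpa using hpos 1
  have h2 : 0 < (θ + 1).det := by simpa only [map_neg, map_one, sub_neg_eq_add] using hpos (-1)
  have hskew : 0 ≤ (G * θ - θ.transpose * G).det := by
    apply Matrix.det_nonneg_of_transpose_eq_neg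
    simp [Matrix.transpose_sub, Matrix.transpose_mul, hsym]
  have hfac : (G * θ - θ.transpose * G) * θ = G * ((θ - 1) * (θ + 1)) := by
    rw [sub_mul, hinv]
    noncomm_ring
  have hdet := congrArg Matrix.det hfac
  simp only [Matrix.det_mul] at hdet
  have hG : 0 ≤ G.det :=
    nonneg_of_mul_nonneg_left (hdet ▸ mul_nonneg hskew h0.le) (mul_pos h1 h2)
  exact lt_of_le_of_ne hG hnd.symm


/-- Let `m ≥ 3` and let `θ` be a real `φ(m) × φ(m)` matrix with
characteristic polynomial `Φ_m`. If `G` is a nondegenerate real symmetric matrix with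
`θᵀ G θ = G`, and `r`, `s` are the numbers of negative and positive eigenvalues of `G`,
then both `r` and `s` are even. -/
theorem signature_even_of_cyclotomic_isometry
    (m : ℕ) (hm : 3 ≤ m) (θ G : Matrix (Fin m.totient) (Fin m.totient) ℝ)
    (hchar : θ.charpoly = Polynomial.cyclotomic m ℝ)
    (hsym : G.transpose = G) (hnd : G.det ≠ 0)
    (hinv : θ.transpose * G * θ = G)
    (hH : G.IsHermitian) (r s : ℕ)
    (hr : r = (Finset.univ.filter fun i => hH.eigenvalues i < 0).card)
    (hs : s = (Finset.univ.filter fun i => 0 < hH.eigenvalues i).card) :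
    Even r ∧ Even s := by
  have heven : Even m.totient := Nat.totient_even hm
  have hdet : 0 < G.det := by
    refine Matrix.det_pos_of_isometry θ G (by simpa using heven) (fun x => ?_) hsym hnd hinv
    rw [hchar]
    exact Polynomial.cyclotomic_pos hm x
  have hprod : G.det = ∏ i, hH.eigenvalues i := by simpa using hH.det_eq_prod_eigenvalues
  have hr_even : Even r := by
    rw [hr]
    exact Finset.even_card_filter_neg_of_prod_pos _ _ (hprod ▸ hdet)
  have hsum : r + s = m.totient := by
    have hcompl : (Finset.univ.filter fun i => 0 < hH.eigenvalues i) =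
        Finset.univ.filter fun i => ¬hH.eigenvalues i < 0 := by
      refine Finset.filter_congr fun i _ => ?_
      have hne : hH.eigenvalues i ≠ 0 :=
        Finset.prod_ne_zero_iff.mp (hprod ▸ hnd) i (Finset.mem_univ i)
      rw [not_lt, lt_iff_le_and_ne, and_iff_left hne.symm]
    rw [hr, hs, hcompl, Finset.card_filter_add_card_filter_not, Finset.card_univ, Fintype.card_fin]
  exact ⟨hr_even, (Nat.even_add.mp (hsum ▸ heven)).mp hr_even⟩
end
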